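/- arXiv:2601.14231 — 2 statements merged into one kernel-verified Lean document; each statement's English description precedes it below -/
import Mathlib

section
/- Let k ≥ 1 be a natural number and let Y be a metric space containing no line, i.e., there is no map γ : ℝ → Y with dist(γ s, γ t) = |s − t| for all real s, t. Let X be the ℓ²-product of EuclideanSpace ℝ (Fin k) and Y, with distance dist((v,y),(w,z)) = sqrt(dist(v,w)² + dist(y,z)²). If γ : ℝ → X satisfies dist(γ s, γ t) = |s − t| for all s, t (i.e., γ is a line in X), then the Y-component of γ is constant and the Euclidean component is affine with unit speed: there exist v, w ∈ EuclideanSpace ℝ (Fin k) with ‖w‖ = 1 and a point y₀ ∈ Y such that γ(t) = (v + t • w, y₀) for every t ∈ ℝ. -/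
/-- Equality in the triangle inequality for the Euclidean norm on the plane: the second
coordinates of the summands are proportional to their lengths and add up exactly. -/
theorem proportional_of_sq_add_sq_eq {a b a₁ b₁ a₂ b₂ l₁ l₂ : ℝ}
    (ha : 0 ≤ a) (hb : 0 ≤ b) (hl₁ : 0 ≤ l₁) (hl₂ : 0 ≤ l₂)
    (h₁ : a₁ ^ 2 + b₁ ^ 2 = l₁ ^ 2) (h₂ : a₂ ^ 2 + b₂ ^ 2 = l₂ ^ 2)
    (h : a ^ 2 + b ^ 2 = (l₁ + l₂) ^ 2) (haa : a ≤ a₁ + a₂) (hbb : b ≤ b₁ + b₂) :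
    b₁ * l₂ = b₂ * l₁ ∧ b = b₁ + b₂ := by
  have hA : a ^ 2 ≤ (a₁ + a₂) ^ 2 := by gcongr
  have hB : b ^ 2 ≤ (b₁ + b₂) ^ 2 := by gcongr
  have hcauchy : a₁ * a₂ + b₁ * b₂ ≤ l₁ * l₂ := by
    apply le_of_sq_le_sq _ (by positivity)
    rw [mul_pow, ← h₁, ← h₂]
    nlinarith [sq_nonneg (a₁ * b₂ - a₂ * b₁)]
  have heq : a₁ * a₂ + b₁ * b₂ = l₁ * l₂ := by nlinarith
  have hsum : (b₁ * l₂ - b₂ * l₁) ^ 2 + (a₁ * l₂ - a₂ * l₁) ^ 2 = 0 := by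
    linear_combination l₂ ^ 2 * h₁ + l₁ ^ 2 * h₂ - 2 * l₁ * l₂ * heq
  constructor
  · have : (b₁ * l₂ - b₂ * l₁) ^ 2 = 0 := by
      nlinarith [sq_nonneg (b₁ * l₂ - b₂ * l₁), sq_nonneg (a₁ * l₂ - a₂ * l₁)]
    exact sub_eq_zero.mp (pow_eq_zero_iff two_ne_zero |>.mp this)
  · refine le_antisymm hbb (le_of_sq_le_sq ?_ hb)
    nlinarith

/-- If two curves in metric spaces jointly form a line in the `ℓ²`-product, then the second one
has constant speed. -/
theorem exists_dist_eq_mul_of_dist_sq_add_dist_sq {X Y : Type*} [PseudoMetricSpace X]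
    [PseudoMetricSpace Y] {f : ℝ → X} {g : ℝ → Y}
    (h : ∀ s t : ℝ, dist (f s) (f t) ^ 2 + dist (g s) (g t) ^ 2 = (s - t) ^ 2) :
    ∃ c : ℝ, 0 ≤ c ∧ ∀ s t : ℝ, dist (g s) (g t) = c * |s - t| := by
  have key {r s t : ℝ} (hrs : r ≤ s) (hst : s ≤ t) :
      dist (g r) (g s) * (t - s) = dist (g s) (g t) * (s - r) ∧
        dist (g r) (g t) = dist (g r) (g s) + dist (g s) (g t) := by
    refine proportional_of_sq_add_sq_eq (a := dist (f r) (f t)) (a₁ := dist (f r) (f s))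
      (a₂ := dist (f s) (f t)) dist_nonneg dist_nonneg
      (sub_nonneg.mpr hrs) (sub_nonneg.mpr hst) ?_ ?_ ?_
      (dist_triangle _ _ _) (dist_triangle _ _ _)
    · rw [h]; ring
    · rw [h]; ring
    · rw [h]; ring
  have sub {r s t u : ℝ} (hrs : r < s) (hst : s ≤ t) (htu : t ≤ u) :
      dist (g s) (g t) * (u - r) = dist (g r) (g u) * (t - s) := by
    obtain ⟨h₁, h₂⟩ := key hrs.le hst
    obtain ⟨h₃, h₄⟩ := key (hrs.le.trans hst) htu
    have h₅ : dist (g s) (g t) * (t - r) = dist (g r) (g t) * (t - s) := by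
      rw [h₂]; linear_combination -h₁
    have h₆ : dist (g r) (g t) * (u - r) = dist (g r) (g u) * (t - r) := by
      rw [h₄]; linear_combination h₃
    have hne : t - r ≠ 0 := (sub_pos.mpr (hrs.trans_le hst)).ne'
    apply mul_right_cancel₀ hne
    linear_combination (u - r) * h₅ + (t - s) * h₆
  have main {s t : ℝ} (hst : s ≤ t) : dist (g s) (g t) = dist (g 0) (g 1) * (t - s) := by
    have hr := min_le_left s 0
    have hr' := min_le_right s 0
    have hu := le_max_left t 1
    have hu' := le_max_right t 1
    have h₁ := sub (r := min s 0 - 1) (u := max t 1) (by linarith) hst hu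
    have h₂ := sub (r := min s 0 - 1) (u := max t 1) (by linarith) zero_le_one hu'
    have hne : max t 1 - (min s 0 - 1) ≠ 0 := by
      apply ne_of_gt
      linarith
    apply mul_right_cancel₀ hne
    linear_combination h₁ - (t - s) * h₂
  refine ⟨dist (g 0) (g 1), dist_nonneg, fun s t => ?_⟩
  rcases le_total s t with hst | hst
  · rw [main hst, abs_sub_comm, abs_of_nonneg (sub_nonneg.mpr hst)]
  · rw [dist_comm, main hst, abs_of_nonneg (sub_nonneg.mpr hst)]


/-- **Lines in `ℝ^k ×₂ Y` are horizontal when `Y` contains no line.**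
If `Y` is a metric space containing no line, and `γ` is a line in the `ℓ²`-product
of `EuclideanSpace ℝ (Fin k)` and `Y`, then the `Y`-component of `γ` is constant and
the Euclidean component is affine with unit speed. -/
theorem line_in_prod_of_no_line (k : ℕ) (hk : 1 ≤ k)
    (Y : Type*) [MetricSpace Y]
    (hY : ¬ ∃ γ : ℝ → Y, ∀ s t : ℝ, dist (γ s) (γ t) = |s - t|)
    (γ : ℝ → WithLp 2 (EuclideanSpace ℝ (Fin k) × Y))
    (hγ : ∀ s t : ℝ, dist (γ s) (γ t) = |s - t|) :
    ∃ (v w : EuclideanSpace ℝ (Fin k)), ‖w‖ = 1 ∧ ∃ y₀ : Y,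
      ∀ t : ℝ, γ t =
        (WithLp.equiv 2 (EuclideanSpace ℝ (Fin k) × Y)).symm (v + t • w, y₀) := by
  have hsq (s t : ℝ) : dist (γ s).fst (γ t).fst ^ 2 + dist (γ s).snd (γ t).snd ^ 2 =
      (s - t) ^ 2 := by
    rw [← sq_abs (s - t), ← hγ, WithLp.prod_dist_eq_add (by norm_num)]
    simp only [ENNReal.toReal_ofNat, Real.rpow_ofNat, ← Real.sqrt_eq_rpow]
    rw [Real.sq_sqrt (by positivity)]
  obtain ⟨c, hc, hdist⟩ := exists_dist_eq_mul_of_dist_sq_add_dist_sq hsq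
  obtain rfl : c = 0 := by
    by_contra hne
    refine hY ⟨fun t => (γ (t / c)).snd, fun s t => ?_⟩
    rw [hdist, ← sub_div, abs_div, abs_of_nonneg hc, mul_div_cancel₀ _ hne]
  have hsnd (t : ℝ) : (γ t).snd = (γ 0).snd := dist_eq_zero.mp (by rw [hdist, zero_mul])
  have hiso : Isometry fun t => (γ t).fst := Isometry.of_dist_eq fun s t => by
    have := hsq s t
    rw [hdist, zero_mul, zero_pow two_ne_zero, add_zero, sq_eq_sq_iff_abs_eq_abs,
      abs_of_nonneg dist_nonneg] at this
    rw [this, Real.dist_eq]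
  let φ := hiso.affineIsometryOfStrictConvexSpace
  refine ⟨φ 0, φ.linearIsometry 1, by simp, (γ 0).snd, fun t => ?_⟩
  have hφ : (γ t).fst = φ 0 + t • φ.linearIsometry 1 := by
    rw [← map_smul, smul_eq_mul, mul_one, add_comm, ← vadd_eq_add, ← φ.map_vadd, vadd_eq_add,
      add_zero]
    rfl
  rw [← hφ, ← hsnd t]
  rfl
end

section
/- Let X be a connected, second-countable, Hausdorff topological 3-manifold without boundary (a topological space locally homeomorphic to EuclideanSpace ℝ (Fin 3)). If X is noncompact, simply connected, and has trivial second homotopy group π₂(X), then X is contractible. -/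
open Set Metric Topology Filter unitInterval

namespace OpenThreeManifold

/-- Maps from the unit cube `[-1, 1]^ι` to `X` which are constant on the boundary are homotopic to
a constant map relative to the boundary. -/
def CubeLoopsNull (ι X : Type*) [Fintype ι] [TopologicalSpace X] : Prop :=
  ∀ (x₀ : X) (g : (ι → ℝ) → X), ContinuousOn g (closedBall 0 1) → (∀ u, ‖u‖ = 1 → g u = x₀) →
    ∃ G : (ι → ℝ) × ℝ → X, ContinuousOn G (closedBall 0 1 ×ˢ Icc 0 1) ∧
      (∀ u ∈ closedBall (0 : ι → ℝ) 1, G (u, 0) = g u) ∧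
      (∀ u ∈ closedBall (0 : ι → ℝ) 1, G (u, 1) = x₀) ∧
      ∀ u t, ‖u‖ = 1 → t ∈ Icc (0 : ℝ) 1 → G (u, t) = x₀

section SphereExtension

variable {ι X : Type*} [Fintype ι] [TopologicalSpace X]

/-- The retraction of a normed space onto its closed unit ball. -/
noncomputable def ballRetraction {E : Type*} [NormedAddCommGroup E] [NormedSpace ℝ E] (x : E) : E :=
  (max 1 ‖x‖)⁻¹ • x

lemma continuous_ballRetraction {E : Type*} [NormedAddCommGroup E] [NormedSpace ℝ E] :
    Continuous (ballRetraction : E → E) := by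
  unfold ballRetraction
  refine Continuous.smul (Continuous.inv₀ (by fun_prop) fun x => ?_) continuous_id
  have : (1 : ℝ) ≤ max 1 ‖x‖ := le_max_left _ _
  positivity

lemma ballRetraction_mem {E : Type*} [NormedAddCommGroup E] [NormedSpace ℝ E] (x : E) :
    ballRetraction x ∈ closedBall (0 : E) 1 := by
  have h1 : (1 : ℝ) ≤ max 1 ‖x‖ := le_max_left _ _
  have h2 : ‖x‖ ≤ max 1 ‖x‖ := le_max_right _ _
  rw [mem_closedBall_zero_iff, ballRetraction, norm_smul, norm_inv, Real.norm_eq_abs,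
    abs_of_nonneg (by positivity), inv_mul_le_iff₀ (by positivity)]
  linarith

lemma ballRetraction_eq {E : Type*} [NormedAddCommGroup E] [NormedSpace ℝ E] {x : E}
    (hx : ‖x‖ ≤ 1) : ballRetraction x = x := by
  rw [ballRetraction, max_eq_left hx, inv_one, one_smul]

/-- A self-map of `(ι → ℝ) × ℝ` collapsing all faces of the unit cube except the top one to the
centre of the bottom face. -/
noncomputable def faceCollapse (x : (ι → ℝ) × ℝ) : (ι → ℝ) × ℝ :=
  ((1 - max ‖x.1‖ ((1 - x.2) / 2)) • x.1, 1 - 2 * max ‖x.1‖ ((1 - x.2) / 2))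

lemma continuous_faceCollapse : Continuous (faceCollapse : (ι → ℝ) × ℝ → (ι → ℝ) × ℝ) := by
  unfold faceCollapse
  fun_prop

lemma norm_eq_one_cases {x : (ι → ℝ) × ℝ} (hx : ‖x‖ = 1) :
    ‖x.1‖ ≤ 1 ∧ |x.2| ≤ 1 ∧ (‖x.1‖ = 1 ∨ x.2 = 1 ∨ x.2 = -1) := by
  rw [Prod.norm_def, Real.norm_eq_abs] at hx
  have h1 : ‖x.1‖ ≤ 1 := hx ▸ le_max_left _ _
  have h2 : |x.2| ≤ 1 := hx ▸ le_max_right _ _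
  refine ⟨h1, h2, ?_⟩
  rcases max_choice ‖x.1‖ |x.2| with h | h
  · left; rw [← h, hx]
  · right
    have : |x.2| = 1 := by rw [← h, hx]
    exact eq_or_eq_neg_of_abs_eq this

lemma faceCollapse_eq {x : (ι → ℝ) × ℝ} (hx : ‖x‖ = 1) (h : ‖x.1‖ = 1 ∨ x.2 = -1) :
    faceCollapse x = (0, -1) := by
  obtain ⟨h1, h2, -⟩ := norm_eq_one_cases hx
  have h3 := abs_le.mp h2
  have : max ‖x.1‖ ((1 - x.2) / 2) = 1 := by
    rcases h with h | h
    · rw [h]; exact max_eq_left (by linarith)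
    · rw [h]; rw [max_eq_right] <;> linarith
  simp only [faceCollapse, this]
  norm_num

lemma faceCollapse_homotopy_ne_zero {x : (ι → ℝ) × ℝ} (hx : ‖x‖ = 1) {t : ℝ}
    (ht : t ∈ Icc (0 : ℝ) 1) : (1 - t) • x + t • faceCollapse x ≠ 0 := by
  obtain ⟨h1, h2, h3⟩ := norm_eq_one_cases hx
  have h2' := abs_le.mp h2
  set s := max ‖x.1‖ ((1 - x.2) / 2) with hs
  have hs1 : s ≤ 1 := max_le h1 (by linarith)
  have hs0 : 0 ≤ s := le_max_of_le_left (norm_nonneg _)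
  intro h
  have e1 : (1 - t * s) • x.1 = 0 := by
    have := congrArg Prod.fst h
    simp only [faceCollapse, Prod.fst_add, Prod.smul_fst, Prod.fst_zero, ← hs] at this
    rw [← this, smul_smul, ← add_smul]; congr 1; ring
  have e2 : (1 - t) * x.2 + t * (1 - 2 * s) = 0 := by
    have := congrArg Prod.snd h
    simpa [faceCollapse, ← hs] using this
  rcases smul_eq_zero.mp e1 with e | e
  · have ht1 : t = 1 := by nlinarith [ht.1, ht.2]
    subst ht1
    have : s = 1 := by linarith
    rw [this] at e2; norm_num at e2
  · have hn : ‖x.1‖ = 0 := by rw [e, norm_zero]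
    rw [hn] at h3
    rcases h3 with h3 | h3 | h3
    · norm_num at h3
    · have : s = 0 := by rw [hs, hn, h3]; norm_num
      rw [this, h3] at e2; norm_num at e2
    · have : s = 1 := by rw [hs, hn, h3]; norm_num
      rw [this, h3] at e2; linarith

/-- If maps of cubes which are constant on the boundary are null-homotopic, then maps on the
boundary of the cube of one dimension more extend to the cube. -/
theorem exists_extension_sphere (hX : CubeLoopsNull ι X) (g : (ι → ℝ) × ℝ → X)
    (hg : ContinuousOn g (sphere 0 1)) :
    ∃ G : C((ι → ℝ) × ℝ, X), EqOn G g (sphere 0 1) := by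
  let Ψ : ((ι → ℝ) × ℝ) × ℝ → (ι → ℝ) × ℝ := fun p => (1 - p.2) • p.1 + p.2 • faceCollapse p.1
  have hΨc : Continuous Ψ := by
    have := continuous_faceCollapse (ι := ι)
    fun_prop
  let Φ : ((ι → ℝ) × ℝ) × ℝ → (ι → ℝ) × ℝ := fun p => ‖Ψ p‖⁻¹ • Ψ p
  have hΨ0 : ∀ p ∈ sphere (0 : (ι → ℝ) × ℝ) 1 ×ˢ Icc (0 : ℝ) 1, Ψ p ≠ 0 := fun p hp =>
    faceCollapse_homotopy_ne_zero (mem_sphere_zero_iff_norm.mp hp.1) hp.2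
  have hΦc : ContinuousOn Φ (sphere (0 : (ι → ℝ) × ℝ) 1 ×ˢ Icc (0 : ℝ) 1) := by
    refine ContinuousOn.smul (ContinuousOn.inv₀ hΨc.norm.continuousOn ?_) hΨc.continuousOn
    exact fun p hp => norm_ne_zero_iff.mpr (hΨ0 p hp)
  have hΦs : MapsTo Φ (sphere (0 : (ι → ℝ) × ℝ) 1 ×ˢ Icc (0 : ℝ) 1) (sphere 0 1) := by
    intro p hp
    rw [mem_sphere_zero_iff_norm, norm_smul, norm_inv, norm_norm,
      inv_mul_cancel₀ (norm_ne_zero_iff.mpr (hΨ0 p hp))]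
  have hΦ0 : ∀ x ∈ sphere (0 : (ι → ℝ) × ℝ) 1, Φ (x, 0) = x := by
    intro x hx
    have : ‖x‖ = 1 := mem_sphere_zero_iff_norm.mp hx
    simp [Φ, Ψ, this]
  have hΦ1 : ∀ x : (ι → ℝ) × ℝ, ‖x‖ = 1 → (‖x.1‖ = 1 ∨ x.2 = -1) → Φ (x, 1) = (0, -1) := by
    intro x hx h
    simp [Φ, Ψ, faceCollapse_eq hx h, Prod.norm_def]
  have hgΦ : ContinuousOn (fun p => g (Φ p)) (sphere (0 : (ι → ℝ) × ℝ) 1 ×ˢ Icc (0 : ℝ) 1) :=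
    hg.comp hΦc hΦs
  -- the map on the top face
  have htop : ∀ u ∈ closedBall (0 : ι → ℝ) 1,
      ((u, 1) : (ι → ℝ) × ℝ) ∈ sphere (0 : (ι → ℝ) × ℝ) 1 := by
    intro u hu
    rw [mem_closedBall_zero_iff] at hu
    simp [Prod.norm_def, hu]
  obtain ⟨G₀, hG₀c, hG₀0, hG₀1, hG₀s⟩ := hX (g (0, -1)) (fun u => g (Φ ((u, 1), 1)))
    (hgΦ.comp (f := fun u : ι → ℝ => (((u, 1) : (ι → ℝ) × ℝ), (1 : ℝ))) (by fun_prop)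
      (fun u hu => ⟨htop u hu, by simp⟩))
    (fun u hu => by
      rw [hΦ1 (u, 1) (by simp [Prod.norm_def, hu]) (Or.inl hu)])
  let G₁ : (ι → ℝ) × ℝ → X := fun x => G₀ (x.1, (1 - x.2) / 2)
  have hG₁c : ContinuousOn G₁ (closedBall 0 1) := by
    refine hG₀c.comp (by fun_prop) fun x hx => ?_
    rw [mem_closedBall_zero_iff, Prod.norm_def, max_le_iff, Real.norm_eq_abs, abs_le] at hx
    exact ⟨mem_closedBall_zero_iff.mpr hx.1, by constructor <;> linarith [hx.2.1, hx.2.2]⟩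
  have hG₁s : ∀ x ∈ sphere (0 : (ι → ℝ) × ℝ) 1, G₁ x = g (Φ (x, 1)) := by
    intro x hx
    rw [mem_sphere_zero_iff_norm] at hx
    obtain ⟨h1, h2, h3⟩ := norm_eq_one_cases hx
    have h2' := abs_le.mp h2
    by_cases h : ‖x.1‖ = 1 ∨ x.2 = -1
    · rw [hΦ1 x hx h]
      rcases h with h | h
      · exact hG₀s _ _ h ⟨by linarith, by linarith⟩
      · have : (1 - x.2) / 2 = 1 := by rw [h]; norm_num
        simp only [G₁, this]
        exact hG₀1 _ (mem_closedBall_zero_iff.mpr h1)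
    · have hx2 : x.2 = 1 := by tauto
      have : x = (x.1, 1) := Prod.ext rfl hx2
      simp only [G₁, hx2, sub_self, zero_div]
      rw [hG₀0 _ (mem_closedBall_zero_iff.mpr h1), ← this]
  classical
  let G : (ι → ℝ) × ℝ → X := fun x => if ‖x‖ ≤ 1 / 2 then G₁ ((2 : ℝ) • x)
    else g (Φ (‖x‖⁻¹ • x, 2 * (1 - ‖x‖)))
  have hsph : ∀ x : (ι → ℝ) × ℝ, 1 / 2 ≤ ‖x‖ → ‖x‖⁻¹ • x ∈ sphere (0 : (ι → ℝ) × ℝ) 1 := by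
    intro x hx
    rw [mem_sphere_zero_iff_norm, norm_smul, norm_inv, norm_norm,
      inv_mul_cancel₀ (by linarith)]
  have hGc : ContinuousOn G (closedBall 0 1) := by
    have hA : ContinuousOn G (closedBall 0 1 ∩ {x | ‖x‖ ≤ 1 / 2}) := by
      refine ContinuousOn.congr (f := fun x => G₁ ((2 : ℝ) • x)) ?_
        (fun x hx => if_pos hx.2)
      refine hG₁c.comp (by fun_prop) fun x hx => ?_
      have := hx.2
      simp only [mem_ofPred_eq] at this
      rw [mem_closedBall_zero_iff, norm_smul, Real.norm_ofNat]; linarith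
    have hB : ContinuousOn G (closedBall 0 1 ∩ {x | 1 / 2 ≤ ‖x‖}) := by
      refine ContinuousOn.congr (f := fun x => g (Φ (‖x‖⁻¹ • x, 2 * (1 - ‖x‖)))) ?_ ?_
      · refine hgΦ.comp (f := fun x : (ι → ℝ) × ℝ => (‖x‖⁻¹ • x, 2 * (1 - ‖x‖))) ?_ ?_
        · refine ContinuousOn.prodMk (ContinuousOn.smul
            (ContinuousOn.inv₀ continuous_norm.continuousOn ?_) continuousOn_id)
            (continuous_const.mul (continuous_const.sub continuous_norm)).continuousOn
          intro x hx h0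
          have := hx.2
          simp only [mem_ofPred_eq] at this
          linarith
        · intro x hx
          have h1 := hx.1
          have h2 : 1 / 2 ≤ ‖x‖ := hx.2
          rw [mem_closedBall_zero_iff] at h1
          exact ⟨hsph x h2, by constructor <;> linarith⟩
      · intro x hx
        have h2 : 1 / 2 ≤ ‖x‖ := hx.2
        by_cases h : ‖x‖ ≤ 1 / 2
        · have hn : ‖x‖ = 1 / 2 := le_antisymm h h2
          simp only [G, if_pos h]
          rw [hG₁s _ (by rw [mem_sphere_zero_iff_norm, norm_smul, Real.norm_ofNat, hn]; norm_num)]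
          rw [hn]; norm_num
        · simp only [G, if_neg h]
    have := hA.union_of_isClosed hB
      (isClosed_closedBall.inter (isClosed_le continuous_norm continuous_const))
      (isClosed_closedBall.inter (isClosed_le continuous_const continuous_norm))
    refine this.mono fun x hx => ?_
    rcases le_total ‖x‖ (1 / 2) with h | h
    · exact Or.inl ⟨hx, h⟩
    · exact Or.inr ⟨hx, h⟩
  refine ⟨⟨fun x => G (ballRetraction x), hGc.comp_continuous continuous_ballRetraction
    ballRetraction_mem⟩, fun x hx => ?_⟩
  have hx1 : ‖x‖ = 1 := mem_sphere_zero_iff_norm.mp hx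
  have : ¬ ((1 : ℝ) ≤ 1 / 2) := by norm_num
  simp only [ContinuousMap.coe_mk, ballRetraction_eq hx1.le, G, hx1, if_neg this]
  simp [hΦ0 x hx]

end SphereExtension

section LowDimensions

variable {ι X : Type*} [Fintype ι] [TopologicalSpace X]

lemma cubeLoopsNull_of_isEmpty [IsEmpty ι] [PathConnectedSpace X] : CubeLoopsNull ι X := by
  intro x₀ g _ hs
  let p : Path (g 0) x₀ := (PathConnectedSpace.joined (g 0) x₀).somePath
  refine ⟨fun q => p.extend q.2, (p.continuous_extend.comp continuous_snd).continuousOn,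
    fun u _ => ?_, fun u _ => ?_, fun u t h => ?_⟩
  · simp [Subsingleton.elim u 0]
  · simp
  · simp [Subsingleton.elim u 0] at h

/-- Affine map from the standard cube to the cube `[-1, 1]^ι`. -/
def cubeScale (y : ι → I) : ι → ℝ := fun i => 2 * (y i : ℝ) - 1

lemma continuous_cubeScale {ι : Type*} : Continuous (cubeScale : (ι → I) → ι → ℝ) := by
  unfold cubeScale; fun_prop

lemma cubeScale_mem (y : ι → I) : cubeScale y ∈ closedBall (0 : ι → ℝ) 1 := by
  rw [mem_closedBall_zero_iff, pi_norm_le_iff_of_nonneg zero_le_one]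
  intro i
  have := (y i).2
  rw [cubeScale, Real.norm_eq_abs, abs_le]
  constructor <;> linarith [this.1, this.2]

lemma norm_cubeScale {y : ι → I} {i : ι} (h : y i = 0 ∨ y i = 1) : ‖cubeScale y‖ = 1 := by
  refine le_antisymm (mem_closedBall_zero_iff.mp (cubeScale_mem y)) ?_
  refine le_trans (le_of_eq ?_) (norm_le_pi_norm _ i)
  rcases h with h | h <;> simp [cubeScale, h]; norm_num

/-- Affine map from the cube `[-1, 1]^ι` to the standard cube. -/
noncomputable def cubeUnscale (u : ι → ℝ) : ι → I :=
  fun i => projIcc 0 1 zero_le_one ((u i + 1) / 2)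

lemma continuous_cubeUnscale {ι : Type*} : Continuous (cubeUnscale : (ι → ℝ) → ι → I) := by
  unfold cubeUnscale
  exact continuous_pi fun i => continuous_projIcc.comp (by fun_prop)

lemma cubeScale_cubeUnscale {u : ι → ℝ} (hu : u ∈ closedBall (0 : ι → ℝ) 1) :
    cubeScale (cubeUnscale u) = u := by
  rw [mem_closedBall_zero_iff, pi_norm_le_iff_of_nonneg zero_le_one] at hu
  ext i
  have := abs_le.mp (hu i)
  rw [cubeScale, cubeUnscale, projIcc_of_mem zero_le_one
    ⟨by linarith [this.1], by linarith [this.2]⟩]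
  ring

lemma cubeUnscale_boundary [Nonempty ι] {u : ι → ℝ} (hu : ‖u‖ = 1) :
    ∃ i, cubeUnscale u i = 0 ∨ cubeUnscale u i = 1 := by
  obtain ⟨i, hi⟩ := Finite.exists_max (fun i => ‖u i‖)
  refine ⟨i, ?_⟩
  have h1 : ‖u‖ ≤ ‖u i‖ := (pi_norm_le_iff_of_nonneg (norm_nonneg _)).mpr hi
  have h2 : |u i| = 1 := le_antisymm (hu ▸ norm_le_pi_norm u i) (hu ▸ h1)
  rcases eq_or_eq_neg_of_abs_eq h2 with h | h
  · right; simp [cubeUnscale, h]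
  · left; simp [cubeUnscale, h]

lemma cubeLoopsNull_of_genLoop [Nonempty ι]
    (h : ∀ (x : X) (f : GenLoop ι X x), GenLoop.Homotopic f GenLoop.const) :
    CubeLoopsNull ι X := by
  intro x₀ g hg hs
  let f : GenLoop ι X x₀ := ⟨⟨fun y => g (cubeScale y),
    hg.comp_continuous continuous_cubeScale cubeScale_mem⟩,
    fun y ⟨i, hi⟩ => hs _ (norm_cubeScale hi)⟩
  obtain ⟨F⟩ := h x₀ f
  refine ⟨fun q => F (projIcc 0 1 zero_le_one q.2, cubeUnscale q.1), ?_, ?_, ?_, ?_⟩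
  · refine (F.continuous.comp (Continuous.prodMk (continuous_projIcc.comp continuous_snd)
      (continuous_cubeUnscale.comp continuous_fst))).continuousOn
  · intro u hu
    simp only [projIcc_left]
    erw [F.apply_zero]
    change g (cubeScale (cubeUnscale u)) = _
    rw [cubeScale_cubeUnscale hu]
  · intro u hu
    simp only [projIcc_right]
    erw [F.apply_one]
    rfl
  · intro u t hu _
    have := F.eq_fst (projIcc 0 1 zero_le_one t) (x := cubeUnscale u) (cubeUnscale_boundary hu)
    refine this.trans ?_
    exact f.2 _ (cubeUnscale_boundary hu)

lemma cubeLoopsNull_of_card_eq_two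
    (hX : ∀ x : X, Subsingleton (HomotopyGroup (Fin 2) X x)) (hι : Fintype.card ι = 2) :
    CubeLoopsNull ι X := by
  have : Nonempty ι := Fintype.card_pos_iff.mp (by omega)
  refine cubeLoopsNull_of_genLoop fun x f => ?_
  let e : ι ≃ Fin 2 := Fintype.equivFinOfCardEq hι
  have h2 : ∀ f : GenLoop (Fin 2) X x, GenLoop.Homotopic f GenLoop.const := fun f =>
    Quotient.exact (Subsingleton.elim (α := HomotopyGroup (Fin 2) X x) (Quotient.mk _ f)
      (Quotient.mk _ GenLoop.const))
  obtain ⟨F⟩ := h2 (GenLoop.congr x e f)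
  let r : C(ι → I, Fin 2 → I) := ⟨fun y j => y (e.symm j), by fun_prop⟩
  refine ⟨⟨⟨⟨fun q => F (q.1, r q.2), F.continuous.comp (by fun_prop)⟩, ?_, ?_⟩, ?_⟩⟩
  · intro y
    dsimp only
    erw [F.apply_zero]
    change f (fun i => y (e.symm (e i))) = f y
    simp
  · intro y
    dsimp only
    erw [F.apply_one]
    rfl
  · rintro t y ⟨i, hi⟩
    have hb : r y ∈ Cube.boundary (Fin 2) := ⟨e i, by simpa [r] using hi⟩
    refine (F.eq_fst t hb).trans ?_
    change f (fun i => y (e.symm (e i))) = f y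
    simp

lemma cubeLoopsNull_of_card_eq_one [SimplyConnectedSpace X] (hι : Fintype.card ι = 1) :
    CubeLoopsNull ι X := by
  have : Nonempty ι := Fintype.card_pos_iff.mp (by omega)
  have : Subsingleton ι := Fintype.card_le_one_iff_subsingleton.mp hι.le
  let i₀ : ι := Classical.arbitrary ι
  refine cubeLoopsNull_of_genLoop fun x f => ?_
  let c : C(I, ι → I) := ⟨fun t _ => t, by fun_prop⟩
  let p : Path x x := ⟨f.1.comp c, f.2 _ ⟨i₀, Or.inl rfl⟩, f.2 _ ⟨i₀, Or.inr rfl⟩⟩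
  obtain ⟨F⟩ := SimplyConnectedSpace.paths_homotopic p (Path.refl x)
  have hy : ∀ y : ι → I, c (y i₀) = y := fun y => by
    ext i; simp [c, Subsingleton.elim i i₀]
  refine ⟨⟨⟨⟨fun q => F (q.1, q.2 i₀), F.continuous.comp (by fun_prop)⟩, ?_, ?_⟩, ?_⟩⟩
  · intro y
    dsimp only
    erw [F.apply_zero]
    change f (c (y i₀)) = f y
    rw [hy]
  · intro y
    dsimp only
    erw [F.apply_one]
    rfl
  · rintro t y ⟨i, hi⟩
    have hb : y i₀ ∈ ({0, 1} : Set I) := by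
      rw [Subsingleton.elim i i₀] at hi
      simpa using hi
    refine (F.eq_fst t hb).trans ?_
    change f (c (y i₀)) = f y
    rw [hy]

theorem cubeLoopsNull_of_card_le_two [SimplyConnectedSpace X]
    (hX : ∀ x : X, Subsingleton (HomotopyGroup (Fin 2) X x)) (hι : Fintype.card ι ≤ 2) :
    CubeLoopsNull ι X := by
  obtain h | h | h : Fintype.card ι = 0 ∨ Fintype.card ι = 1 ∨ Fintype.card ι = 2 := by omega
  · have := Fintype.card_eq_zero_iff.mp h
    exact cubeLoopsNull_of_isEmpty
  · exact cubeLoopsNull_of_card_eq_one h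
  · exact cubeLoopsNull_of_card_eq_two hX h

end LowDimensions

section Gluing

variable {Y Z : Type*} [TopologicalSpace Y] [TopologicalSpace Z]

lemma continuousOn_union_inter {A B D : Set Y} {f : Y → Z} (hA : IsClosed A) (hB : IsClosed B)
    (hfA : ContinuousOn f (A ∩ D)) (hfB : ContinuousOn f (B ∩ D)) :
    ContinuousOn f ((A ∪ B) ∩ D) := by
  classical
  rw [union_inter_distrib_right]
  intro x _
  refine .union ?_ ?_
  · by_cases h : x ∈ A ∩ D
    · exact hfA x h
    · by_cases hxA : x ∈ A
      · have hxD : x ∉ D := fun hD => h ⟨hxA, hD⟩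
        rename_i hx
        rcases hx with hx | hx
        · exact absurd hx.2 hxD
        · exact absurd hx.2 hxD
      · exact continuousWithinAt_of_notMem_closure fun hc =>
          hxA (hA.closure_subset (closure_mono inter_subset_left hc))
  · by_cases h : x ∈ B ∩ D
    · exact hfB x h
    · by_cases hxB : x ∈ B
      · have hxD : x ∉ D := fun hD => h ⟨hxB, hD⟩
        rename_i hx
        rcases hx with hx | hx
        · exact absurd hx.2 hxD
        · exact absurd hx.2 hxD
      · exact continuousWithinAt_of_notMem_closure fun hc =>
          hxB (hB.closure_subset (closure_mono inter_subset_left hc))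

lemma exists_glue {A B D : Set Y} {f g : Y → Z} (hA : IsClosed A) (hB : IsClosed B)
    (hf : ContinuousOn f (A ∩ D)) (hg : ContinuousOn g (B ∩ D))
    (hfg : EqOn f g (A ∩ B ∩ D)) :
    ∃ k : Y → Z, ContinuousOn k ((A ∪ B) ∩ D) ∧ EqOn k f (A ∩ D) ∧ EqOn k g (B ∩ D) := by
  classical
  have h1 : EqOn (fun x => if x ∈ A then f x else g x) f (A ∩ D) := fun x hx => if_pos hx.1
  have h2 : EqOn (fun x => if x ∈ A then f x else g x) g (B ∩ D) := by
    intro x hx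
    by_cases hxA : x ∈ A
    · simp only [if_pos hxA]; exact hfg ⟨⟨hxA, hx.1⟩, hx.2⟩
    · simp only [if_neg hxA]
  exact ⟨_, continuousOn_union_inter hA hB (hf.congr h1) (hg.congr h2), h1, h2⟩

end Gluing

section Paths

variable {Y X : Type*} [TopologicalSpace Y] [TopologicalSpace X]

/-- The path-valued map `h` is a contraction of `Φ` to `x₀` on the set `S`. -/
def ContractsOn (Φ : Y → X) (x₀ : X) (h : Y → C(I, X)) (S : Set Y) : Prop :=
  ContinuousOn h S ∧ ∀ x ∈ S, h x 0 = Φ x ∧ h x 1 = x₀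

lemma ContractsOn.mono {Φ : Y → X} {x₀ : X} {h : Y → C(I, X)} {S T : Set Y}
    (H : ContractsOn Φ x₀ h T) (hST : S ⊆ T) : ContractsOn Φ x₀ h S :=
  ⟨H.1.mono hST, fun x hx => H.2 x (hST hx)⟩

lemma ContractsOn.glue {Φ : Y → X} {x₀ : X} {f g : Y → C(I, X)} {A B D : Set Y}
    (hA : IsClosed A) (hB : IsClosed B) (hf : ContractsOn Φ x₀ f (A ∩ D))
    (hg : ContractsOn Φ x₀ g (B ∩ D)) (hfg : EqOn f g (A ∩ B ∩ D)) :
    ∃ k, ContractsOn Φ x₀ k ((A ∪ B) ∩ D) ∧ EqOn k f (A ∩ D) ∧ EqOn k g (B ∩ D) := by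
  obtain ⟨k, hk, hkf, hkg⟩ := exists_glue hA hB hf.1 hg.1 hfg
  refine ⟨k, ⟨hk, fun x hx => ?_⟩, hkf, hkg⟩
  rcases hx with ⟨hx | hx, hD⟩
  · rw [hkf ⟨hx, hD⟩]; exact hf.2 x ⟨hx, hD⟩
  · rw [hkg ⟨hx, hD⟩]; exact hg.2 x ⟨hx, hD⟩

lemma exists_curry [Nonempty X] {S : Set Y} {G : Y → ℝ → X}
    (hG : ContinuousOn (Function.uncurry G) (S ×ˢ Icc (0 : ℝ) 1)) :
    ∃ h : Y → C(I, X), ContinuousOn h S ∧ ∀ x ∈ S, ∀ t : I, h x t = G x t := by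
  refine ⟨_, ContinuousMap.continuousOn_mkD_restrict_of_uncurry G
    (ContinuousMap.const _ (Classical.arbitrary X)) hG, fun x hx t => ?_⟩
  rw [ContinuousMap.mkD_of_continuousOn]
  · rfl
  · exact hG.comp (Continuous.prodMk_right x).continuousOn fun _ hz => ⟨hx, hz⟩

end Paths

section Cells

/-- The cell of the cubical structure on `ℝ³` with vertices the points with even coordinates, whose
centre is the integral point `a`. -/
def cell (a : Fin 3 → ℤ) : Set (Fin 3 → ℝ) := {x | ∀ i, |x i - a i| ≤ (a i % 2 : ℤ)}

/-- The boundary of a cell. -/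
def cellBoundary (a : Fin 3 → ℤ) : Set (Fin 3 → ℝ) :=
  {x ∈ cell a | ∃ i, a i % 2 = 1 ∧ |x i - a i| = 1}

/-- The cell with centre `b` is a face of the cell with centre `a`. -/
def IsFace (b a : Fin 3 → ℤ) : Prop := ∀ i, |b i - a i| ≤ a i % 2

/-- The dimension of a cell. -/
def cellDim (a : Fin 3 → ℤ) : ℤ := ∑ i, a i % 2

/-- The cell with centre `a` is three-dimensional. -/
def IsTop (a : Fin 3 → ℤ) : Prop := ∀ i, a i % 2 = 1

/-- The coordinate directions of a cell. -/
abbrev Directions (a : Fin 3 → ℤ) : Type := {i : Fin 3 // a i % 2 = 1}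

lemma isFace_refl (a : Fin 3 → ℤ) : IsFace a a := fun i => by
  rw [sub_self, abs_zero]; omega

lemma isFace_trans {a b c : Fin 3 → ℤ} (h : IsFace a b) (h' : IsFace b c) : IsFace a c := by
  intro i
  have h1 := h i
  have h2 := h' i
  rw [abs_le] at *
  omega

lemma IsFace.cell_subset {a b : Fin 3 → ℤ} (h : IsFace b a) : cell b ⊆ cell a := by
  intro x hx i
  have h1 := h i
  have h2 := hx i
  have h3 : ((|b i - a i| : ℤ) : ℝ) + ((b i % 2 : ℤ) : ℝ) ≤ ((a i % 2 : ℤ) : ℝ) := by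
    have : |b i - a i| + b i % 2 ≤ a i % 2 := by
      rcases abs_cases (b i - a i) with ⟨h, -⟩ | ⟨h, -⟩ <;> rw [h] at h1 ⊢ <;> omega
    exact_mod_cast this
  have h4 : |x i - a i| ≤ |x i - b i| + |(b i : ℝ) - a i| := abs_sub_le _ _ _
  push_cast at h3
  linarith

lemma IsFace.dim_lt {a b : Fin 3 → ℤ} (h : IsFace b a) (hne : b ≠ a) : cellDim b < cellDim a := by
  obtain ⟨i, hi⟩ := Function.ne_iff.mp hne
  refine Finset.sum_lt_sum (fun j _ => ?_) ⟨i, Finset.mem_univ _, ?_⟩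
  · have := h j
    rw [abs_le] at this; omega
  · have := h i
    rw [abs_le] at this; omega

lemma IsTop.eq_of_isFace {a b : Fin 3 → ℤ} (ha : IsTop a) (h : IsFace a b) : a = b := by
  ext i
  have h1 := h i
  have h2 := ha i
  rw [abs_le] at h1; omega

lemma isFace_of_mem_interior {a c : Fin 3 → ℤ} {x : Fin 3 → ℝ} (ha : x ∈ cell a)
    (hb : x ∉ cellBoundary a) (hc : x ∈ cell c) : IsFace a c := by
  intro i
  have h1 := ha i
  have h2 := hc i
  rcases Int.emod_two_eq_zero_or_one (a i) with h | h
  · rw [h] at h1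
    have : x i = a i := by
      have : |x i - a i| = 0 := le_antisymm (by exact_mod_cast h1) (abs_nonneg _)
      linarith [abs_eq_zero.mp this]
    rw [this] at h2
    exact_mod_cast h2
  · rw [h] at h1
    have h3 : |x i - a i| < 1 := lt_of_le_of_ne (by exact_mod_cast h1) fun h' => hb ⟨ha, i, h, h'⟩
    have h4 : |(a i : ℝ) - c i| ≤ |(a i : ℝ) - x i| + |x i - c i| := abs_sub_le _ _ _
    rw [abs_sub_comm (a i : ℝ) (x i)] at h4
    have h5 : ((|a i - c i| : ℤ) : ℝ) < ((1 + c i % 2 : ℤ) : ℝ) := by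
      push_cast at h2 ⊢; linarith
    have h6 : |a i - c i| < 1 + c i % 2 := by exact_mod_cast h5
    rw [abs_lt] at h6
    rw [abs_le]
    omega

lemma exists_isFace_of_mem_cellBoundary {a : Fin 3 → ℤ} {x : Fin 3 → ℝ}
    (hx : x ∈ cellBoundary a) : ∃ b, IsFace b a ∧ b ≠ a ∧ x ∈ cell b := by
  obtain ⟨hx, i, hi, hxi⟩ := hx
  obtain ⟨n, hn, hxn⟩ : ∃ n : ℤ, (n = a i + 1 ∨ n = a i - 1) ∧ x i = n := by
    rcases eq_or_eq_neg_of_abs_eq hxi with h | h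
    · exact ⟨a i + 1, Or.inl rfl, by push_cast; linarith⟩
    · exact ⟨a i - 1, Or.inr rfl, by push_cast; linarith⟩
  refine ⟨Function.update a i n, fun j => ?_, fun h => ?_, fun j => ?_⟩
  · by_cases hj : j = i
    · subst hj
      rw [Function.update_self, abs_le]; omega
    · rw [Function.update_of_ne hj]; exact isFace_refl a j
  · have := congrFun h i
    rw [Function.update_self] at this; omega
  · by_cases hj : j = i
    · subst hj
      have : n % 2 = 0 := by omega
      rw [Function.update_self, hxn, this]; simp
    · rw [Function.update_of_ne hj]; exact hx j

lemma isClosed_cell (a : Fin 3 → ℤ) : IsClosed (cell a) := by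
  have : cell a = ⋂ i, {x : Fin 3 → ℝ | |x i - a i| ≤ (a i % 2 : ℤ)} := by
    ext x; simp [cell]
  rw [this]
  exact isClosed_iInter fun i => isClosed_le (by fun_prop) (by fun_prop)

lemma center_mem_cell (a : Fin 3 → ℤ) : (fun i => (a i : ℝ)) ∈ cell a := fun i => by
  rw [sub_self, abs_zero]
  exact_mod_cast (isFace_refl a i).trans' (abs_nonneg _)

lemma center_notMem_cellBoundary (a : Fin 3 → ℤ) : (fun i => (a i : ℝ)) ∉ cellBoundary a := by
  rintro ⟨-, i, -, h⟩
  simp at h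

lemma norm_sub_le_of_mem_cell {a : Fin 3 → ℤ} {x : Fin 3 → ℝ} (hx : x ∈ cell a) :
    ‖x - fun i => (a i : ℝ)‖ ≤ 1 := by
  rw [pi_norm_le_iff_of_nonneg zero_le_one]
  intro i
  refine (hx i).trans ?_
  have : a i % 2 ≤ 1 := by omega
  exact_mod_cast this

lemma dist_le_of_mem_cell {a : Fin 3 → ℤ} {x y : Fin 3 → ℝ} (hx : x ∈ cell a) (hy : y ∈ cell a) :
    dist x y ≤ 2 := by
  have h1 := norm_sub_le_of_mem_cell hx
  have h2 := norm_sub_le_of_mem_cell hy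
  rw [← dist_eq_norm] at h1 h2
  linarith [dist_triangle_right x y (fun i => (a i : ℝ))]

lemma exists_isTop_mem_cell (x : Fin 3 → ℝ) : ∃ a, IsTop a ∧ x ∈ cell a := by
  refine ⟨fun i => 2 * ⌊x i / 2⌋ + 1, fun i => by dsimp only; omega, fun i => ?_⟩
  have h1 := Int.floor_le (x i / 2)
  have h2 := Int.lt_floor_add_one (x i / 2)
  have h3 : (2 * ⌊x i / 2⌋ + 1) % 2 = 1 := by omega
  rw [h3, abs_le]
  push_cast
  constructor <;> linarith

/-- Coordinates on a cell. -/
def cellCoord (a : Fin 3 → ℤ) (x : Fin 3 → ℝ) : Directions a → ℝ := fun i => x i - a i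

/-- Parametrization of a cell by a cube. -/
def cellParam (a : Fin 3 → ℤ) (u : Directions a → ℝ) : Fin 3 → ℝ :=
  fun i => a i + if hi : a i % 2 = 1 then u ⟨i, hi⟩ else 0

lemma continuous_cellParam (a : Fin 3 → ℤ) : Continuous (cellParam a) := by
  refine continuous_pi fun i => ?_
  by_cases hi : a i % 2 = 1
  · simp only [cellParam, dif_pos hi]; fun_prop
  · simp only [cellParam, dif_neg hi]; fun_prop

lemma continuous_cellCoord (a : Fin 3 → ℤ) : Continuous (cellCoord a) := by
  unfold cellCoord; fun_prop

lemma cellParam_mem {a : Fin 3 → ℤ} {u : Directions a → ℝ} (hu : ‖u‖ ≤ 1) :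
    cellParam a u ∈ cell a := by
  intro i
  by_cases hi : a i % 2 = 1
  · simp only [cellParam, hi, add_sub_cancel_left]
    exact_mod_cast (norm_le_pi_norm u ⟨i, hi⟩).trans hu
  · have : a i % 2 = 0 := by omega
    simp [cellParam, this]

lemma exists_abs_eq_norm {κ : Type*} [Fintype κ] {u : κ → ℝ} (hu : ‖u‖ = 1) :
    ∃ i, |u i| = 1 := by
  have : Nonempty κ := by
    by_contra h
    rw [not_nonempty_iff] at h
    rw [Subsingleton.elim u 0, norm_zero] at hu
    exact zero_ne_one hu
  obtain ⟨i, hi⟩ := Finite.exists_max (fun i => ‖u i‖)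
  exact ⟨i, le_antisymm (hu ▸ norm_le_pi_norm u i)
    (hu ▸ (pi_norm_le_iff_of_nonneg (norm_nonneg _)).mpr hi)⟩

lemma cellParam_mem_boundary {a : Fin 3 → ℤ} {u : Directions a → ℝ} (hu : ‖u‖ = 1) :
    cellParam a u ∈ cellBoundary a := by
  refine ⟨cellParam_mem hu.le, ?_⟩
  obtain ⟨⟨i, hi⟩, h⟩ := exists_abs_eq_norm hu
  exact ⟨i, hi, by simpa only [cellParam, dif_pos hi, add_sub_cancel_left] using h⟩

lemma norm_cellCoord_le {a : Fin 3 → ℤ} {x : Fin 3 → ℝ} (hx : x ∈ cell a) :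
    ‖cellCoord a x‖ ≤ 1 := by
  rw [pi_norm_le_iff_of_nonneg zero_le_one]
  rintro ⟨i, hi⟩
  have := hx i
  rw [hi] at this
  exact_mod_cast this

lemma norm_cellCoord_eq {a : Fin 3 → ℤ} {x : Fin 3 → ℝ} (hx : x ∈ cellBoundary a) :
    ‖cellCoord a x‖ = 1 := by
  obtain ⟨hx, i, hi, h⟩ := hx
  exact le_antisymm (norm_cellCoord_le hx) (h ▸ norm_le_pi_norm (cellCoord a x) ⟨i, hi⟩)

lemma cellParam_cellCoord {a : Fin 3 → ℤ} {x : Fin 3 → ℝ} (hx : x ∈ cell a) :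
    cellParam a (cellCoord a x) = x := by
  ext i
  by_cases hi : a i % 2 = 1
  · simp [cellParam, cellCoord, hi]
  · have h0 : a i % 2 = 0 := by omega
    have := hx i
    rw [h0] at this
    have : |x i - a i| = 0 := le_antisymm (by exact_mod_cast this) (abs_nonneg _)
    simp only [cellParam, dif_neg hi]
    linarith [abs_eq_zero.mp this]

variable {X : Type*} [TopologicalSpace X] {Φ : (Fin 3 → ℝ) → X} {x₀ : X}

/-- A contraction on the boundary of a cell of dimension at most two extends to the cell. -/
theorem ContractsOn.exists_extend_cell {a : Fin 3 → ℤ} (hX : CubeLoopsNull (Directions a) X)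
    (hΦ : ContinuousOn Φ (cell a)) {h : (Fin 3 → ℝ) → C(I, X)}
    (hh : ContractsOn Φ x₀ h (cellBoundary a)) :
    ∃ k, ContractsOn Φ x₀ k (cell a) ∧ EqOn k h (cellBoundary a) := by
  classical
  let g : (Directions a → ℝ) × ℝ → X := fun p =>
    if ‖p.1‖ = 1 then h (cellParam a p.1) (projIcc 0 1 zero_le_one ((p.2 + 1) / 2))
    else if p.2 = -1 then Φ (cellParam a p.1) else x₀
  have hg0 : ∀ u, ‖u‖ ≤ 1 → g (u, -1) = Φ (cellParam a u) := by
    intro u hu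
    by_cases h1 : ‖u‖ = 1
    · simp only [g, if_pos h1, neg_add_cancel, zero_div, projIcc_left]
      exact (hh.2 _ (cellParam_mem_boundary h1)).1
    · simp [g, if_neg h1]
  have hg1 : ∀ u, ‖u‖ ≤ 1 → g (u, 1) = x₀ := by
    intro u hu
    by_cases h1 : ‖u‖ = 1
    · have : ((1 : ℝ) + 1) / 2 = 1 := by norm_num
      simp only [g, if_pos h1, this, projIcc_right]
      exact (hh.2 _ (cellParam_mem_boundary h1)).2
    · have : (1 : ℝ) ≠ -1 := by norm_num
      simp [g, if_neg h1, this]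
  have hgc : ContinuousOn g (sphere 0 1) := by
    have c1 : ContinuousOn g {p | ‖p.1‖ = 1} := by
      refine ContinuousOn.congr (f := fun p => h (cellParam a p.1)
        (projIcc 0 1 zero_le_one ((p.2 + 1) / 2))) ?_ fun p hp => ?_
      swap
      · have : ‖p.1‖ = 1 := hp
        simp only [g, if_pos this]
      refine ContinuousOn.eval (hh.1.comp (f := fun p : (Directions a → ℝ) × ℝ => cellParam a p.1)
        ((continuous_cellParam a).comp continuous_fst).continuousOn
          fun p hp => cellParam_mem_boundary hp) ?_
      exact (continuous_projIcc.comp (by fun_prop)).continuousOn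
    have c2 : ContinuousOn g {p | ‖p.1‖ ≤ 1 ∧ p.2 = -1} := by
      refine ContinuousOn.congr (f := fun p => Φ (cellParam a p.1)) ?_ fun p hp => ?_
      · exact hΦ.comp ((continuous_cellParam a).comp continuous_fst).continuousOn
          fun p hp => cellParam_mem hp.1
      · dsimp only
        rw [← hg0 p.1 hp.1, ← hp.2]
    have c3 : ContinuousOn g {p | ‖p.1‖ ≤ 1 ∧ p.2 = 1} := by
      refine ContinuousOn.congr (f := fun p => x₀) continuousOn_const fun p hp => ?_
      dsimp only
      rw [← hg1 p.1 hp.1, ← hp.2]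
    have hc1 : IsClosed {p : (Directions a → ℝ) × ℝ | ‖p.1‖ = 1} :=
      isClosed_eq (by fun_prop) (by fun_prop)
    have hc2 : IsClosed {p : (Directions a → ℝ) × ℝ | ‖p.1‖ ≤ 1 ∧ p.2 = -1} :=
      (isClosed_le continuous_fst.norm continuous_const).inter
        (isClosed_eq continuous_snd continuous_const)
    have hc3 : IsClosed {p : (Directions a → ℝ) × ℝ | ‖p.1‖ ≤ 1 ∧ p.2 = 1} :=
      (isClosed_le continuous_fst.norm continuous_const).inter
        (isClosed_eq continuous_snd continuous_const)
    refine ((c1.union_of_isClosed c2 hc1 hc2).union_of_isClosed c3 (hc1.union hc2) hc3).mono ?_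
    intro p hp
    obtain ⟨h1, -, h3⟩ := norm_eq_one_cases (mem_sphere_zero_iff_norm.mp hp)
    rcases h3 with h3 | h3 | h3
    · exact Or.inl (Or.inl h3)
    · exact Or.inr ⟨h1, h3⟩
    · exact Or.inl (Or.inr ⟨h1, h3⟩)
  obtain ⟨G, hG⟩ := exists_extension_sphere hX g hgc
  let H : C((Fin 3 → ℝ) × I, X) := G.comp ⟨fun p => (cellCoord a p.1, 2 * (p.2 : ℝ) - 1), by
    have := continuous_cellCoord a
    fun_prop⟩
  have hH : ∀ x t, H.curry x t = G (cellCoord a x, 2 * (t : ℝ) - 1) := fun x t => rfl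
  refine ⟨H.curry, ⟨H.curry.continuous.continuousOn, fun x hx => ⟨?_, ?_⟩⟩, fun x hx => ?_⟩
  · have h1 := norm_cellCoord_le hx
    rw [hH, hG]
    · simp only [Icc.coe_zero, mul_zero, zero_sub]
      rw [hg0 _ h1, cellParam_cellCoord hx]
    · simp [Prod.norm_def, h1]
  · have h1 := norm_cellCoord_le hx
    have h2 : 2 * ((1 : I) : ℝ) - 1 = 1 := by rw [Icc.coe_one]; norm_num
    rw [hH, h2, hG]
    · exact hg1 _ h1
    · simp [Prod.norm_def, h1]
  · have h1 := norm_cellCoord_eq hx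
    ext t
    rw [hH, hG]
    · have : (2 * (t : ℝ) - 1 + 1) / 2 = t := by ring
      simp only [g, if_pos h1, cellParam_cellCoord hx.1, this, projIcc_val]
    · have : |2 * (t : ℝ) - 1| ≤ 1 := by
        rw [abs_le]; constructor <;> linarith [t.2.1, t.2.2]
      simp [Prod.norm_def, h1, this]

lemma mem_cell_iff {a : Fin 3 → ℤ} (ha : IsTop a) {x : Fin 3 → ℝ} :
    x ∈ cell a ↔ ‖x - fun i => (a i : ℝ)‖ ≤ 1 := by
  refine ⟨norm_sub_le_of_mem_cell, fun h i => ?_⟩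
  rw [ha i]
  exact_mod_cast (norm_le_pi_norm (x - fun i => (a i : ℝ)) i).trans h

lemma mem_cellBoundary_iff {a : Fin 3 → ℤ} (ha : IsTop a) {x : Fin 3 → ℝ} :
    x ∈ cellBoundary a ↔ ‖x - fun i => (a i : ℝ)‖ = 1 := by
  constructor
  · rintro ⟨hx, i, -, h⟩
    exact le_antisymm (norm_sub_le_of_mem_cell hx)
      (h ▸ norm_le_pi_norm (x - fun i => (a i : ℝ)) i)
  · intro h
    obtain ⟨i, hi⟩ := exists_abs_eq_norm h
    exact ⟨(mem_cell_iff ha).mpr h.le, i, ha i, hi⟩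

/-- A contraction on the boundary of a three-dimensional cell extends to the complement of the
centre of the cell. -/
theorem ContractsOn.exists_extend_punctured_cell {a : Fin 3 → ℤ} (ha : IsTop a)
    (hΦ : ContinuousOn Φ (cell a)) {h : (Fin 3 → ℝ) → C(I, X)}
    (hh : ContractsOn Φ x₀ h (cellBoundary a)) :
    ∃ k, ContractsOn Φ x₀ k (cell a \ {fun i => (a i : ℝ)}) ∧ EqOn k h (cellBoundary a) := by
  classical
  have : Nonempty X := ⟨x₀⟩
  set c : Fin 3 → ℝ := fun i => (a i : ℝ) with hc
  let Γ : (Fin 3 → ℝ) × ℝ → X := fun p =>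
    if p.2 ≤ 0 then Φ (c + (1 + p.2) • p.1) else h (c + p.1) (projIcc 0 1 zero_le_one p.2)
  have hbd : ∀ u : Fin 3 → ℝ, ‖u‖ = 1 → c + u ∈ cellBoundary a := fun u hu => by
    rw [mem_cellBoundary_iff ha, ← hc, add_sub_cancel_left, hu]
  have hΓh : ∀ u : Fin 3 → ℝ, ‖u‖ = 1 → ∀ s, 0 ≤ s →
      Γ (u, s) = h (c + u) (projIcc 0 1 zero_le_one s) := by
    intro u hu s hs
    by_cases h0 : s ≤ 0
    · obtain rfl : s = 0 := le_antisymm h0 hs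
      simp only [Γ, le_refl, if_true, add_zero, one_smul, projIcc_left]
      exact (hh.2 _ (hbd u hu)).1.symm
    · simp only [Γ, if_neg h0]
  have hΓc : ContinuousOn Γ (sphere 0 1 ×ˢ Icc (-1) 1) := by
    have c1 : ContinuousOn Γ (sphere 0 1 ×ˢ Icc (-1) 0) := by
      refine ContinuousOn.congr (f := fun p => Φ (c + (1 + p.2) • p.1)) ?_
        fun p hp => if_pos hp.2.2
      refine hΦ.comp (by fun_prop) fun p hp => ?_
      have h1 : ‖p.1‖ = 1 := mem_sphere_zero_iff_norm.mp hp.1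
      rw [mem_cell_iff ha, ← hc, add_sub_cancel_left, norm_smul, h1, mul_one, Real.norm_eq_abs,
        abs_le]
      constructor <;> linarith [hp.2.1, hp.2.2]
    have c2 : ContinuousOn Γ (sphere 0 1 ×ˢ Icc 0 1) := by
      refine ContinuousOn.congr (f := fun p => h (c + p.1) (projIcc 0 1 zero_le_one p.2)) ?_
        fun p hp => hΓh p.1 (mem_sphere_zero_iff_norm.mp hp.1) p.2 hp.2.1
      refine ContinuousOn.eval (hh.1.comp (f := fun p : (Fin 3 → ℝ) × ℝ => c + p.1) (by fun_prop)
        fun p hp => hbd p.1 (mem_sphere_zero_iff_norm.mp hp.1)) ?_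
      exact (continuous_projIcc.comp continuous_snd).continuousOn
    refine (c1.union_of_isClosed c2 (isClosed_sphere.prod isClosed_Icc)
      (isClosed_sphere.prod isClosed_Icc)).mono ?_
    rintro p ⟨hp, hp1, hp2⟩
    rcases le_total p.2 0 with h0 | h0
    · exact Or.inl ⟨hp, hp1, h0⟩
    · exact Or.inr ⟨hp, h0, hp2⟩
  have hpos : ∀ x ∈ cell a \ {c}, 0 < ‖x - c‖ := fun x hx =>
    norm_pos_iff.mpr (sub_ne_zero.mpr hx.2)
  have hle : ∀ x ∈ cell a \ {c}, ‖x - c‖ ≤ 1 := fun x hx => (mem_cell_iff ha).mp hx.1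
  have hunit : ∀ x ∈ cell a \ {c}, ‖‖x - c‖⁻¹ • (x - c)‖ = 1 := fun x hx => by
    rw [norm_smul, norm_inv, norm_norm, inv_mul_cancel₀ (hpos x hx).ne']
  obtain ⟨k, hkc, hk⟩ := exists_curry (S := cell a \ {c})
    (G := fun x t => Γ (‖x - c‖⁻¹ • (x - c), ‖x - c‖ - 1 + t * (2 - ‖x - c‖))) (by
      refine hΓc.comp (f := fun p : (Fin 3 → ℝ) × ℝ =>
        (‖p.1 - c‖⁻¹ • (p.1 - c), ‖p.1 - c‖ - 1 + p.2 * (2 - ‖p.1 - c‖))) ?_ ?_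
      · have hinv : ContinuousOn (fun p : (Fin 3 → ℝ) × ℝ => ‖p.1 - c‖⁻¹)
            ((cell a \ {c}) ×ˢ Icc 0 1) :=
          ContinuousOn.inv₀ (by fun_prop) fun p hp => (hpos p.1 hp.1).ne'
        exact (hinv.smul (by fun_prop)).prodMk (by fun_prop)
      · rintro p ⟨hp, ht0, ht1⟩
        refine ⟨mem_sphere_zero_iff_norm.mpr (hunit p.1 hp), ?_, ?_⟩
        · have := hpos p.1 hp
          have := hle p.1 hp
          dsimp only
          nlinarith
        · have := hpos p.1 hp
          have := hle p.1 hp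
          dsimp only
          nlinarith)
  refine ⟨k, ⟨hkc, fun x hx => ⟨?_, ?_⟩⟩, fun x hx => ?_⟩
  · rw [hk x hx]
    have h1 : ‖x - c‖ - 1 ≤ 0 := by linarith [hle x hx]
    simp only [Icc.coe_zero, zero_mul, add_zero, Γ, if_pos h1, add_sub_cancel]
    rw [smul_smul, mul_inv_cancel₀ (hpos x hx).ne', one_smul, add_sub_cancel]
  · rw [hk x hx]
    have h1 : ‖x - c‖ - 1 + ((1 : I) : ℝ) * (2 - ‖x - c‖) = 1 := by
      rw [Icc.coe_one]; ring
    rw [h1, hΓh _ (hunit x hx) _ zero_le_one, projIcc_right]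
    exact (hh.2 _ (hbd _ (hunit x hx))).2
  · have hx' : x ∈ cell a \ {c} := ⟨hx.1, by
      rintro rfl
      exact center_notMem_cellBoundary a hx⟩
    ext t
    have hn : ‖x - c‖ = 1 := (mem_cellBoundary_iff ha).mp hx
    have h1 : (1 : ℝ) - 1 + t * (2 - 1) = t := by ring
    rw [hk x hx', hn, h1, inv_one, one_smul, hΓh _ hn _ t.2.1, projIcc_val, add_sub_cancel]

end Cells

section Complexes

variable {X : Type*} [TopologicalSpace X] {Φ : (Fin 3 → ℝ) → X} {x₀ : X}

/-- The union of a finite set of cells. -/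
def cells (T : Finset (Fin 3 → ℤ)) : Set (Fin 3 → ℝ) := ⋃ a ∈ T, cell a

lemma isClosed_cells (T : Finset (Fin 3 → ℤ)) : IsClosed (cells T) :=
  T.finite_toSet.isClosed_biUnion fun a _ => isClosed_cell a

lemma mem_cells {T : Finset (Fin 3 → ℤ)} {x : Fin 3 → ℝ} : x ∈ cells T ↔ ∃ a ∈ T, x ∈ cell a := by
  simp [cells]

lemma cell_subset_cells {T : Finset (Fin 3 → ℤ)} {a : Fin 3 → ℤ} (ha : a ∈ T) :
    cell a ⊆ cells T := fun _ hx => mem_cells.mpr ⟨a, ha, hx⟩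

lemma cells_insert [DecidableEq (Fin 3 → ℤ)] (T : Finset (Fin 3 → ℤ)) (a : Fin 3 → ℤ) :
    cells (insert a T) = cells T ∪ cell a := by
  rw [cells, Finset.set_biUnion_insert, union_comm, cells]

lemma cells_empty : cells ∅ = ∅ := by simp [cells]

/-- A contraction extends over cells of dimension at most two. -/
theorem ContractsOn.exists_extend_skeleton
    (hX : ∀ a, ¬ IsTop a → CubeLoopsNull (Directions a) X) {T₀ C : Finset (Fin 3 → ℤ)}
    {P : Set (Fin 3 → ℝ)} {h : (Fin 3 → ℝ) → C(I, X)} (hh : ContractsOn Φ x₀ h (cells T₀ \ P))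
    (hC : ∀ a ∈ C, ¬ IsTop a) (hCf : ∀ a ∈ C, ∀ b, IsFace b a → b ∈ C)
    (hΦ : ContinuousOn Φ (cells C)) (hP : ∀ a ∈ C, Disjoint (cell a) P) :
    ∃ k, ContractsOn Φ x₀ k ((cells T₀ ∪ cells C) \ P) ∧ EqOn k h (cells T₀ \ P) := by
  classical
  induction C using Finset.induction_on_max_value cellDim with
  | empty => exact ⟨h, by rwa [cells_empty, union_empty], fun _ _ => rfl⟩
  | insert a s has hmax ih =>
    rw [cells_insert] at hΦ ⊢
    obtain ⟨k, hk, hkh⟩ := ih (fun c hc => hC c (Finset.mem_insert_of_mem hc))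
      (fun c hc b hb => by
        rcases Finset.mem_insert.mp (hCf c (Finset.mem_insert_of_mem hc) b hb) with rfl | hb'
        · have hne : b ≠ c := by rintro rfl; exact has hc
          exact absurd (hmax c hc) (not_le.mpr (hb.dim_lt hne))
        · exact hb')
      (hΦ.mono subset_union_left) (fun c hc => hP c (Finset.mem_insert_of_mem hc))
    by_cases hface : ∃ c ∈ T₀, IsFace a c
    · obtain ⟨c, hc, hac⟩ := hface
      have : cells T₀ ∪ (cells s ∪ cell a) = cells T₀ ∪ cells s := by
        rw [← union_assoc, union_eq_left]
        exact (hac.cell_subset.trans (cell_subset_cells hc)).trans subset_union_left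
      rw [this]
      exact ⟨k, hk, hkh⟩
    · have haP := hP a (Finset.mem_insert_self a s)
      have hbd : cellBoundary a ⊆ cells s := by
        intro x hx
        obtain ⟨b, hb, hne, hxb⟩ := exists_isFace_of_mem_cellBoundary hx
        have := hCf a (Finset.mem_insert_self a s) b hb
        exact cell_subset_cells (Finset.mem_of_mem_insert_of_ne this hne) hxb
      obtain ⟨k', hk', hkk'⟩ := ContractsOn.exists_extend_cell
        (hX a (hC a (Finset.mem_insert_self a s))) (hΦ.mono subset_union_right)
        (hk.mono fun x hx => ⟨Or.inr (hbd hx), haP.notMem_of_mem_left hx.1⟩)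
      obtain ⟨l, hl, hlk, -⟩ := ContractsOn.glue (A := cells T₀ ∪ cells s) (B := cell a) (D := Pᶜ)
        ((isClosed_cells _).union (isClosed_cells _)) (isClosed_cell a) hk
        (hk'.mono inter_subset_left) (by
          rintro x ⟨⟨hx1, hx2⟩, -⟩
          refine (hkk' ?_).symm
          by_contra hx
          rcases hx1 with hx1 | hx1
          · obtain ⟨c, hc, hxc⟩ := mem_cells.mp hx1
            exact hface ⟨c, hc, isFace_of_mem_interior hx2 hx hxc⟩
          · obtain ⟨c, hc, hxc⟩ := mem_cells.mp hx1
            have hne : a ≠ c := by rintro rfl; exact has hc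
            exact absurd (hmax c hc) (not_le.mpr ((isFace_of_mem_interior hx2 hx hxc).dim_lt hne)))
      refine ⟨l, ?_, fun x hx => ?_⟩
      · rw [← union_assoc]; exact hl
      · rw [hlk ⟨Or.inl hx.1, hx.2⟩, hkh hx]

/-- A contraction extends over three-dimensional cells away from their centres. -/
theorem ContractsOn.exists_extend_top {B : Set (Fin 3 → ℝ)} (hB : IsClosed B)
    {T : Finset (Fin 3 → ℤ)} (hT : ∀ a ∈ T, IsTop a) {Q : Set (Fin 3 → ℝ)}
    {h : (Fin 3 → ℝ) → C(I, X)} (hh : ContractsOn Φ x₀ h (B \ Q))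
    (hΦ : ContinuousOn Φ (cells T)) (hTB : ∀ a ∈ T, cellBoundary a ⊆ B \ Q)
    (hBT : ∀ a ∈ T, cell a ∩ B ⊆ cellBoundary a) (hTQ : ∀ a ∈ T, (fun i => (a i : ℝ)) ∈ Q) :
    ∃ k, ContractsOn Φ x₀ k ((B ∪ cells T) \ Q) ∧ EqOn k h (B \ Q) := by
  classical
  induction T using Finset.induction_on with
  | empty => exact ⟨h, by rwa [cells_empty, union_empty], fun _ _ => rfl⟩
  | insert a s has ih =>
    rw [cells_insert] at hΦ ⊢
    obtain ⟨k, hk, hkh⟩ := ih (fun c hc => hT c (Finset.mem_insert_of_mem hc))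
      (hΦ.mono subset_union_left) (fun c hc => hTB c (Finset.mem_insert_of_mem hc))
      (fun c hc => hBT c (Finset.mem_insert_of_mem hc))
      (fun c hc => hTQ c (Finset.mem_insert_of_mem hc))
    have has' := Finset.mem_insert_self a s
    have haT := hT a has'
    obtain ⟨k', hk', hkk'⟩ := ContractsOn.exists_extend_punctured_cell haT
      (hΦ.mono subset_union_right)
      (hk.mono fun x hx => ⟨Or.inl (hTB a has' hx).1, (hTB a has' hx).2⟩)
    obtain ⟨l, hl, hlk, -⟩ := ContractsOn.glue (A := B ∪ cells s) (B := cell a) (D := Qᶜ)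
      (hB.union (isClosed_cells _)) (isClosed_cell a) hk
      (hk'.mono fun x hx => ⟨hx.1, by rintro rfl; exact hx.2 (hTQ a has')⟩) (by
        rintro x ⟨⟨hx1, hx2⟩, -⟩
        refine (hkk' ?_).symm
        by_contra hx
        rcases hx1 with hx1 | hx1
        · exact hx (hBT a has' ⟨hx2, hx1⟩)
        · obtain ⟨c, hc, hxc⟩ := mem_cells.mp hx1
          exact has (haT.eq_of_isFace (isFace_of_mem_interior hx2 hx hxc) ▸ hc))
    refine ⟨l, ?_, fun x hx => ?_⟩
    · rw [← union_assoc]; exact hl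
    · rw [hlk ⟨Or.inl hx.1, hx.2⟩, hkh hx]

/-- A contraction on a union of three-dimensional cells extends to a larger union of cells, away
from the centres of the new cells. -/
theorem ContractsOn.exists_extend_cells
    (hX : ∀ a, ¬ IsTop a → CubeLoopsNull (Directions a) X) {T₀ T : Finset (Fin 3 → ℤ)}
    (hT : ∀ a ∈ T, IsTop a) {P : Set (Fin 3 → ℝ)} {h : (Fin 3 → ℝ) → C(I, X)}
    (hh : ContractsOn Φ x₀ h (cells T₀ \ P)) (hΦ : ContinuousOn Φ (cells T))
    (hP : ∀ x ∈ P, x ∈ cells T → ∀ i (n : ℤ), x i ≠ 2 * n) :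
    ∃ k, ContractsOn Φ x₀ k (cells T \ (P ∪ (fun a i => (a i : ℝ)) '' (T \ T₀ : Set (Fin 3 → ℤ)))) ∧
      EqOn k h (cells T₀ \ P) := by
  classical
  set Z : Set (Fin 3 → ℝ) := (fun a i => (a i : ℝ)) '' (T \ T₀ : Set (Fin 3 → ℤ)) with hZ
  let C : Finset (Fin 3 → ℤ) :=
    T.biUnion fun a => (Finset.Icc (a - 1) (a + 1)).filter fun b => IsFace b a ∧ ¬ IsTop b
  have hmemC : ∀ b, b ∈ C ↔ ∃ a ∈ T, IsFace b a ∧ ¬ IsTop b := by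
    intro b
    simp only [C, Finset.mem_biUnion, Finset.mem_filter, Finset.mem_Icc]
    refine exists_congr fun a => and_congr_right fun _ => and_iff_right_of_imp fun h => ?_
    refine ⟨fun i => ?_, fun i => ?_⟩ <;> have := h.1 i <;> rw [abs_le] at this <;>
      simp only [Pi.sub_apply, Pi.add_apply, Pi.one_apply] <;> omega
  have hCT : cells C ⊆ cells T := by
    intro x hx
    obtain ⟨b, hb, hxb⟩ := mem_cells.mp hx
    obtain ⟨a, ha, hba, -⟩ := (hmemC b).mp hb
    exact mem_cells.mpr ⟨a, ha, hba.cell_subset hxb⟩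
  have hCP : ∀ a ∈ C, Disjoint (cell a) P := by
    intro a ha
    rw [Set.disjoint_left]
    intro x hx hxP
    obtain ⟨i, hi⟩ := not_forall.mp ((hmemC a).mp ha).choose_spec.2.2
    have h0 : a i % 2 = 0 := by omega
    have h1 := hx i
    rw [h0] at h1
    have h2 : |x i - a i| = 0 := le_antisymm (by exact_mod_cast h1) (abs_nonneg _)
    refine hP x hxP (hCT (cell_subset_cells ha hx)) i (a i / 2) ?_
    have h3 : a i = 2 * (a i / 2) := by omega
    have h4 : (a i : ℝ) = 2 * ((a i / 2 : ℤ) : ℝ) := by exact_mod_cast h3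
    linarith [abs_eq_zero.mp h2]
  obtain ⟨k, hk, hkh⟩ := hh.exists_extend_skeleton (C := C) hX
    (fun a ha => ((hmemC a).mp ha).choose_spec.2.2) (fun a ha b hb => by
      obtain ⟨c, hc, hac, hatop⟩ := (hmemC a).mp ha
      exact (hmemC b).mpr ⟨c, hc, isFace_trans hb hac,
        fun hbt => hatop (hbt.eq_of_isFace hb ▸ hbt)⟩)
    (hΦ.mono hCT) hCP
  have hbd : ∀ a ∈ T, cellBoundary a ⊆ cells C := by
    intro a ha x hx
    obtain ⟨b, hb, hne, hxb⟩ := exists_isFace_of_mem_cellBoundary hx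
    exact mem_cells.mpr ⟨b, (hmemC b).mpr ⟨a, ha, hb, fun hbt => hne (hbt.eq_of_isFace hb)⟩, hxb⟩
  have hZn : ∀ c, (c ∈ T₀ ∨ c ∈ C) → ∀ z ∈ Z, z ∉ cell c := by
    rintro c hc _ ⟨a, ⟨haT, haT₀⟩, rfl⟩ hz
    have := (hT a haT).eq_of_isFace
      (isFace_of_mem_interior (center_mem_cell a) (center_notMem_cellBoundary a) hz)
    subst this
    rcases hc with hc | hc
    · exact haT₀ hc
    · exact ((hmemC a).mp hc).choose_spec.2.2 (hT a haT)
  obtain ⟨l, hl, hlk⟩ := ContractsOn.exists_extend_top (B := cells T₀ ∪ cells C) (T := T \ T₀)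
    (Q := P ∪ Z) ((isClosed_cells _).union (isClosed_cells _))
    (fun a ha => hT a (Finset.mem_sdiff.mp ha).1)
    (hk.mono (sdiff_subset_sdiff_right subset_union_left))
    (hΦ.mono fun x hx => by
      obtain ⟨a, ha, hxa⟩ := mem_cells.mp hx
      exact mem_cells.mpr ⟨a, (Finset.mem_sdiff.mp ha).1, hxa⟩)
    (fun a ha x hx => by
      have hxC := hbd a (Finset.mem_sdiff.mp ha).1 hx
      obtain ⟨c, hc, hxc⟩ := mem_cells.mp hxC
      refine ⟨Or.inr hxC, ?_⟩
      rintro (hxP | hxZ)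
      · exact (hCP c hc).notMem_of_mem_left hxc hxP
      · exact hZn c (Or.inr hc) x hxZ hxc)
    (fun a ha x hx => by
      obtain ⟨haT, haT₀⟩ := Finset.mem_sdiff.mp ha
      by_contra hxb
      rcases hx.2 with hx2 | hx2 <;> obtain ⟨c, hc, hxc⟩ := mem_cells.mp hx2 <;>
        have := (hT a haT).eq_of_isFace (isFace_of_mem_interior hx.1 hxb hxc) <;> subst this
      · exact haT₀ hc
      · exact ((hmemC a).mp hc).choose_spec.2.2 (hT a haT))
    (fun a ha => Or.inr ⟨a, by simpa using ha, rfl⟩)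
  refine ⟨l, hl.mono ?_, fun x hx => ?_⟩
  · rintro x ⟨hx, hxQ⟩
    obtain ⟨a, ha, hxa⟩ := mem_cells.mp hx
    refine ⟨?_, hxQ⟩
    by_cases ha₀ : a ∈ T₀
    · exact Or.inl (Or.inl (cell_subset_cells ha₀ hxa))
    · exact Or.inr (cell_subset_cells (Finset.mem_sdiff.mpr ⟨ha, ha₀⟩) hxa)
  · have hxZ : x ∉ Z := fun hz => by
      obtain ⟨c, hc, hxc⟩ := mem_cells.mp hx.1
      exact hZn c (Or.inl hc) x hz hxc
    rw [hlk ⟨Or.inl hx.1, by rintro (h | h); exacts [hx.2 h, hxZ h]⟩, hkh hx]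

end Complexes

section ChartStep

lemma exists_forall_ne {ι α : Type*} [Countable α] (f : α → ι → ℝ) :
    ∃ τ : ι → ℝ, ∀ a i, τ i ≠ f a i := by
  have : ∀ i, ∃ t : ℝ, ∀ a, t ≠ f a i := by
    intro i
    obtain ⟨t, ht⟩ := ((countable_range fun a => f a i).dense_compl ℝ).nonempty
    exact ⟨t, fun a h => ht ⟨a, h.symm⟩⟩
  choose τ hτ using this
  exact ⟨τ, fun a i => hτ i a⟩

lemma finite_setOf_mem_cell (M : ℝ) : {a : Fin 3 → ℤ | ∃ y ∈ cell a, ‖y‖ ≤ M}.Finite := by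
  refine (Set.finite_Icc (fun _ : Fin 3 => -⌈M + 1⌉) fun _ => ⌈M + 1⌉).subset ?_
  rintro a ⟨y, hy, hM⟩
  have h : ∀ i, |(a i : ℝ)| ≤ ⌈M + 1⌉ := fun i => by
    have h1 := (norm_le_pi_norm (y - fun i => (a i : ℝ)) i).trans (norm_sub_le_of_mem_cell hy)
    have h2 := (norm_le_pi_norm y i).trans hM
    rw [Real.norm_eq_abs] at h1 h2
    have h3 : |(a i : ℝ)| ≤ |(a i : ℝ) - y i| + |y i| := by
      simpa using abs_sub_le (a i : ℝ) (y i) 0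
    rw [abs_sub_comm] at h3
    simp only [Pi.sub_apply] at h1
    exact (by linarith : |(a i : ℝ)| ≤ M + 1).trans (Int.le_ceil _)
  have h' : ∀ i, |a i| ≤ ⌈M + 1⌉ := fun i => by exact_mod_cast h i
  exact ⟨fun i => (abs_le.mp (h' i)).1, fun i => (abs_le.mp (h' i)).2⟩

lemma isCompact_cells (T : Finset (Fin 3 → ℤ)) : IsCompact (cells T) := by
  refine T.finite_toSet.isCompact_biUnion fun a _ => ?_
  refine Metric.isCompact_of_isClosed_isBounded (isClosed_cell a)
    ((isBounded_closedBall (x := fun i => (a i : ℝ)) (r := 1)).subset fun x hx => ?_)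
  rw [mem_closedBall, dist_eq_norm]
  exact norm_sub_le_of_mem_cell hx

variable {X : Type*} [TopologicalSpace X] [T2Space X] [LocallyCompactSpace X] {x₀ : X}

/-- A contraction of an open set away from finitely many points can be extended, without changing
it on a given compact set, over a compact ball in a chart, at the cost of finitely many points. -/
theorem ContractsOn.exists_extend_chart
    (hX : ∀ a, ¬ IsTop a → CubeLoopsNull (Directions a) X)
    (φ : OpenPartialHomeomorph X (Fin 3 → ℝ)) {c : Fin 3 → ℝ} {r R : ℝ} (hrR : r < R)
    (hR : closedBall c R ⊆ φ.target) {A U P : Set X} {h : X → C(I, X)} (hA : IsCompact A)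
    (hU : IsOpen U) (hAU : A ⊆ U) (hP : P.Finite) (hh : ContractsOn id x₀ h (U \ P)) :
    ∃ (U' P' : Set X) (h' : X → C(I, X)), IsOpen U' ∧ A ∪ φ.symm '' closedBall c r ⊆ U' ∧
      P'.Finite ∧ ContractsOn id x₀ h' (U' \ P') ∧
      ∀ x ∈ A, (x ∈ P' ↔ x ∈ P) ∧ (x ∉ P → h' x = h x) := by
  classical
  obtain ⟨A₁, hA₁, hAA₁, hA₁U⟩ := exists_compact_between hA hU hAU
  set R₁ : ℝ := (r + R) / 2 with hR₁
  have hrR₁ : r < R₁ := by linarith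
  have hR₁R : R₁ < R := by linarith
  have hcs : ContinuousOn φ.symm (closedBall c R) := φ.continuousOn_symm.mono hR
  set K : Set (Fin 3 → ℝ) := closedBall c R ∩ φ.symm ⁻¹' A₁ with hK
  have hKc : IsCompact K := (isCompact_closedBall c R).of_isClosed_subset
    (hcs.preimage_isClosed_of_isClosed isClosed_closedBall hA₁.isClosed) inter_subset_left
  obtain ⟨δ, hδ, hδK⟩ := hKc.exists_cthickening_subset_open (φ.isOpen_inter_preimage_symm hU)
    (fun y hy => ⟨hR hy.1, hA₁U hy.2⟩ : K ⊆ φ.target ∩ φ.symm ⁻¹' U)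
  obtain ⟨m, hm, hmδ, hmR⟩ : ∃ m : ℝ, 0 < m ∧ 2 * m ≤ δ ∧ 2 * m ≤ R - R₁ := by
    refine ⟨min δ (R - R₁) / 2, ?_, ?_, ?_⟩
    · have : 0 < min δ (R - R₁) := lt_min hδ (by linarith)
      linarith
    · linarith [min_le_left δ (R - R₁)]
    · linarith [min_le_right δ (R - R₁)]
  have := hP.to_subtype
  obtain ⟨τ, hτ⟩ := exists_forall_ne fun (a : P × ℤ) (i : Fin 3) => φ a.1 i - m * (2 * a.2)
  let Λ : (Fin 3 → ℝ) → (Fin 3 → ℝ) := fun y => τ + m • y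
  have hΛdist : ∀ y z, dist (Λ y) (Λ z) = m * dist y z := fun y z => by
    rw [dist_add_left, dist_smul₀, Real.norm_of_nonneg hm.le]
  have hΛc : Continuous Λ := by fun_prop
  have hTfin : {a : Fin 3 → ℤ | IsTop a ∧ ∃ y ∈ cell a, Λ y ∈ closedBall c R₁}.Finite := by
    refine (finite_setOf_mem_cell (m⁻¹ * (R₁ + ‖c‖ + ‖τ‖))).subset ?_
    rintro a ⟨-, y, hy, hyR⟩
    refine ⟨y, hy, ?_⟩
    have h1 : y = m⁻¹ • (Λ y - τ) := by
      rw [add_sub_cancel_left, smul_smul, inv_mul_cancel₀ hm.ne', one_smul]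
    have h2 : ‖Λ y‖ ≤ R₁ + ‖c‖ := by
      rw [mem_closedBall, dist_eq_norm] at hyR
      have := norm_le_norm_sub_add (Λ y) c
      linarith
    rw [h1, norm_smul, norm_inv, Real.norm_of_nonneg hm.le]
    gcongr
    exact (norm_sub_le _ _).trans (by linarith)
  set T : Finset (Fin 3 → ℤ) := hTfin.toFinset with hT
  have hTmem : ∀ a, a ∈ T ↔ IsTop a ∧ ∃ y ∈ cell a, Λ y ∈ closedBall c R₁ := fun a => by
    rw [hT, Set.Finite.mem_toFinset]; rfl
  set T₀ : Finset (Fin 3 → ℤ) := T.filter fun a => ∃ y ∈ cell a, Λ y ∈ K with hT₀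
  have hTR : ∀ y ∈ cells T, Λ y ∈ closedBall c R := by
    intro y hy
    obtain ⟨a, ha, hya⟩ := mem_cells.mp hy
    obtain ⟨-, z, hza, hz⟩ := (hTmem a).mp ha
    have h1 := hΛdist y z
    have h2 := dist_le_of_mem_cell hya hza
    rw [mem_closedBall] at hz ⊢
    have h3 := dist_triangle (Λ y) (Λ z) c
    nlinarith
  have hT₀U : ∀ y ∈ cells T₀, φ.symm (Λ y) ∈ U := by
    intro y hy
    obtain ⟨a, ha, hya⟩ := mem_cells.mp hy
    obtain ⟨-, z, hza, hz⟩ := Finset.mem_filter.mp ha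
    refine (hδK (mem_cthickening_of_dist_le (Λ y) (Λ z) δ K hz ?_)).2
    have h1 := hΛdist y z
    have h2 := dist_le_of_mem_cell hya hza
    nlinarith
  have hT₀mem : ∀ a ∈ T, ∀ y ∈ cell a, φ.symm (Λ y) ∈ A₁ → a ∈ T₀ := fun a ha y hy hyA =>
    Finset.mem_filter.mpr ⟨ha, y, hy, hTR y (cell_subset_cells ha hy), hyA⟩
  set Φ : (Fin 3 → ℝ) → X := fun y => φ.symm (Λ y) with hΦ
  have hΦc : ContinuousOn Φ (cells T) := hcs.comp hΛc.continuousOn hTR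
  have hφΦ : ∀ y ∈ cells T, φ (Φ y) = Λ y := fun y hy => φ.right_inv (hR (hTR y hy))
  have hT₀T : cells T₀ ⊆ cells T := fun y hy => by
    obtain ⟨a, ha, hya⟩ := mem_cells.mp hy
    exact cell_subset_cells (Finset.filter_subset _ _ ha) hya
  obtain ⟨k, hk, hkh⟩ := ContractsOn.exists_extend_cells (Φ := Φ) (x₀ := x₀) (T₀ := T₀) (T := T)
    (P := Φ ⁻¹' P) (h := h ∘ Φ) hX (fun a ha => ((hTmem a).mp ha).1)
    ⟨hh.1.comp (hΦc.mono (sdiff_subset.trans hT₀T)) fun y hy => ⟨hT₀U y hy.1, hy.2⟩,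
      fun y hy => hh.2 _ ⟨hT₀U y hy.1, hy.2⟩⟩ hΦc (fun y hyP hy i n hin => by
        refine hτ (⟨Φ y, hyP⟩, n) i ?_
        simp only [hφΦ y hy, Λ, Pi.add_apply, Pi.smul_apply, smul_eq_mul, hin]
        ring)
  set Z : Set (Fin 3 → ℝ) := (fun a i => (a i : ℝ)) '' (T \ T₀ : Set (Fin 3 → ℤ)) with hZ
  have hZT : ∀ z ∈ Z, z ∈ cells T ∧ Φ z ∉ A₁ := by
    rintro _ ⟨a, ⟨haT, haT₀⟩, rfl⟩
    exact ⟨cell_subset_cells haT (center_mem_cell a),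
      fun hA => haT₀ (hT₀mem a haT _ (center_mem_cell a) hA)⟩
  let Ψ : X → (Fin 3 → ℝ) := fun x => m⁻¹ • (φ x - τ)
  have hΨΦ : ∀ y ∈ cells T, Ψ (Φ y) = y := fun y hy => by
    simp only [Ψ, hφΦ y hy, Λ, add_sub_cancel_left, smul_smul, inv_mul_cancel₀ hm.ne', one_smul]
  set V : Set X := Φ '' cells T with hV
  have hVc : IsCompact V := (isCompact_cells T).image_of_continuousOn hΦc
  have hVs : V ⊆ φ.source := by
    rintro _ ⟨y, hy, rfl⟩
    exact φ.map_target (hR (hTR y hy))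
  have hΨc : ContinuousOn Ψ V := 
    ((φ.continuousOn.mono hVs).sub (continuousOn_const (c := τ))).const_smul m⁻¹
  have hmaps : ∀ x ∈ V ∩ (P ∪ Φ '' Z)ᶜ, Ψ x ∈ cells T \ (Φ ⁻¹' P ∪ Z) ∧ Φ (Ψ x) = x := by
    rintro _ ⟨⟨y, hy, rfl⟩, hx⟩
    rw [hΨΦ y hy]
    refine ⟨⟨hy, ?_⟩, rfl⟩
    rintro (hyP | hyZ)
    · exact hx (Or.inl hyP)
    · exact hx (Or.inr ⟨y, hyZ, rfl⟩)
  obtain ⟨h', hh', hh'h, -⟩ := ContractsOn.glue (Φ := id) (x₀ := x₀) (f := h) (g := k ∘ Ψ)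
    (A := A₁) (B := V) (D := (P ∪ Φ '' Z)ᶜ) hA₁.isClosed hVc.isClosed
    (hh.mono fun x hx => ⟨hA₁U hx.1, fun hxP => hx.2 (Or.inl hxP)⟩)
    ⟨hk.1.comp (hΨc.mono inter_subset_left) fun x hx => (hmaps x hx).1, fun x hx => by
      have := hk.2 _ (hmaps x hx).1
      rwa [(hmaps x hx).2] at this⟩ (by
    rintro x ⟨⟨hxA, y, hy, rfl⟩, hxP⟩
    obtain ⟨a, ha, hya⟩ := mem_cells.mp hy
    rw [Function.comp_apply, hΨΦ y hy, hkh]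
    · rfl
    · exact ⟨cell_subset_cells (hT₀mem a ha y hya hxA) hya, fun hyP => hxP (Or.inl hyP)⟩)
  refine ⟨interior (A₁ ∪ V), P ∪ Φ '' Z, h', isOpen_interior, union_subset ?_ ?_, ?_, ?_, ?_⟩
  · exact hAA₁.trans (interior_mono subset_union_left)
  · have hop : IsOpen (φ.symm '' ball c R₁) := φ.symm.isOpen_image_of_subset_source isOpen_ball
      ((ball_subset_closedBall.trans (closedBall_subset_closedBall hR₁R.le)).trans hR)
    refine (image_mono (closedBall_subset_ball hrR₁)).trans (hop.subset_interior_iff.mpr ?_)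
    rintro _ ⟨z, hz, rfl⟩
    refine Or.inr ⟨m⁻¹ • (z - τ), ?_, ?_⟩
    · obtain ⟨a, ha, hza⟩ := exists_isTop_mem_cell (m⁻¹ • (z - τ))
      refine cell_subset_cells ((hTmem a).mpr ⟨ha, _, hza, ?_⟩) hza
      simp only [Λ, smul_smul, mul_inv_cancel₀ hm.ne', one_smul, add_sub_cancel]
      exact ball_subset_closedBall hz
    · simp only [Φ, Λ, smul_smul, mul_inv_cancel₀ hm.ne', one_smul, add_sub_cancel]
  · exact hP.union (((T.finite_toSet.subset sdiff_subset).image _).image _)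
  · exact hh'.mono (sdiff_subset_sdiff_left interior_subset)
  · intro x hx
    have hxZ : x ∉ Φ '' Z := by
      rintro ⟨z, hz, rfl⟩
      exact (hZT z hz).2 (interior_subset (hAA₁ hx))
    refine ⟨by simp [hxZ], fun hxP => hh'h ⟨interior_subset (hAA₁ hx), ?_⟩⟩
    rintro (h | h)
    exacts [hxP h, hxZ h]

end ChartStep

section Exhaustion

lemma exists_chart_closedBall {X E : Type*} [TopologicalSpace X] [NormedAddCommGroup E]
    (φ : OpenPartialHomeomorph X E) {x : X} (hx : x ∈ φ.source) :
    ∃ R, 0 < R ∧ closedBall (φ x) R ⊆ φ.target := by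
  obtain ⟨R, hR, h⟩ := Metric.isOpen_iff.mp φ.open_target _ (φ.map_source hx)
  exact ⟨R / 2, half_pos hR, (closedBall_subset_ball (half_lt_self hR)).trans h⟩

lemma isOpen_symm_image_ball {X E : Type*} [TopologicalSpace X] [NormedAddCommGroup E]
    (φ : OpenPartialHomeomorph X E) {c : E} {R : ℝ} (h : ball c R ⊆ φ.target) :
    IsOpen (φ.symm '' ball c R) :=
  φ.symm.isOpen_image_of_subset_source isOpen_ball h

variable {X : Type*} [TopologicalSpace X] [T2Space X] [LocallyCompactSpace X]
  [SecondCountableTopology X]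

/-- A three-manifold all of whose loops and two-spheres are null-homotopic can be contracted in
itself away from a locally finite set. -/
theorem exists_contractsOn_compl (hX : ∀ a, ¬ IsTop a → CubeLoopsNull (Directions a) X)
    (hφ : ∀ x : X, ∃ φ : OpenPartialHomeomorph X (Fin 3 → ℝ), x ∈ φ.source) (x₀ : X) :
    ∃ (P : Set X) (h : X → C(I, X)), (∀ x, ∃ W ∈ 𝓝 x, (W ∩ P).Finite) ∧
      ContractsOn id x₀ h Pᶜ := by
  classical
  choose φ hφ using hφ
  choose R hR hRt using fun x => exists_chart_closedBall (φ x) (hφ x)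
  let B : X → Set X := fun x => (φ x).symm '' closedBall (φ x x) (R x / 2)
  have hBc : ∀ x, IsCompact (B x) := fun x => (isCompact_closedBall _ _).image_of_continuousOn
    ((φ x).continuousOn_symm.mono
      ((closedBall_subset_closedBall (half_le_self (hR x).le)).trans (hRt x)))
  have hBn : ∀ x, interior (B x) ∈ 𝓝 x := by
    intro x
    refine interior_mem_nhds.mpr (mem_of_superset (IsOpen.mem_nhds
      (isOpen_symm_image_ball (φ x) (c := φ x x) (R := R x / 2) ?_) ?_)
      (image_mono ball_subset_closedBall))
    · exact (ball_subset_closedBall.trans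
        (closedBall_subset_closedBall (half_le_self (hR x).le))).trans (hRt x)
    · exact ⟨φ x x, mem_ball_self (half_pos (hR x)), (φ x).left_inv (hφ x)⟩
  obtain ⟨s, hsc, hs⟩ := TopologicalSpace.countable_cover_nhds hBn
  have hsne : s.Nonempty := by
    by_contra h
    rw [not_nonempty_iff_eq_empty] at h
    rw [h, biUnion_empty] at hs
    exact (hs ▸ mem_univ x₀ : x₀ ∈ (∅ : Set X))
  obtain ⟨e, rfl⟩ := hsc.exists_eq_range hsne
  rw [biUnion_range] at hs
  let S := {s : Set X × Set X × (X → C(I, X)) //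
    IsCompact s.1 ∧ s.2.1.Finite ∧ ∃ U, IsOpen U ∧ s.1 ⊆ U ∧ ContractsOn id x₀ s.2.2 (U \ s.2.1)}
  have hstep : ∀ (n : ℕ) (s : S), ∃ s' : S, s'.1.1 = s.1.1 ∪ B (e n) ∧ ∀ x ∈ s.1.1,
      (x ∈ s'.1.2.1 ↔ x ∈ s.1.2.1) ∧ (x ∉ s.1.2.1 → s'.1.2.2 x = s.1.2.2 x) := by
    rintro n ⟨⟨A, P, h⟩, hA, hP, U, hU, hAU, hh⟩
    obtain ⟨U', P', h', hU', hAU', hP', hh', hag⟩ := hh.exists_extend_chart hX (φ (e n))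
      (half_lt_self (hR (e n))) (hRt (e n)) hA hU hAU hP
    exact ⟨⟨⟨A ∪ B (e n), P', h'⟩, hA.union (hBc _), hP', U', hU', hAU', hh'⟩, rfl, hag⟩
  choose next hnextK hnext using hstep
  let s₀ : S := ⟨⟨∅, ∅, fun _ => ContinuousMap.const _ x₀⟩, isCompact_empty, finite_empty, ∅,
    isOpen_empty, Subset.rfl, by simp [ContractsOn]⟩
  let sq : ℕ → S := fun n => Nat.rec s₀ next n
  have hsq : ∀ n, sq (n + 1) = next n (sq n) := fun n => rfl
  set K : ℕ → Set X := fun n => (sq n).1.1 with hK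
  have hKmono : Monotone K := monotone_nat_of_le_succ fun n => by
    simp only [K, hsq, hnextK]
    exact subset_union_left
  have hKB : ∀ n, B (e n) ⊆ K (n + 1) := fun n => by
    simp only [K, hsq, hnextK]
    exact subset_union_right
  have hcons : ∀ m n, m ≤ n → ∀ x ∈ K m, (x ∈ (sq n).1.2.1 ↔ x ∈ (sq m).1.2.1) ∧
      (x ∉ (sq m).1.2.1 → (sq n).1.2.2 x = (sq m).1.2.2 x) := by
    intro m n hmn x hx
    induction n, hmn using Nat.le_induction with
    | base => simp
    | succ n hmn ih =>
      have h1 := hnext n (sq n) x (hKmono hmn hx)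
      rw [← hsq] at h1
      refine ⟨h1.1.trans ih.1, fun hxP => ?_⟩
      rw [h1.2 (fun h => hxP (ih.1.mp h)), ih.2 hxP]
  have hcov : ∀ x, ∃ n, K n ∈ 𝓝 x := by
    intro x
    obtain ⟨n, hn⟩ := mem_iUnion.mp (hs ▸ mem_univ x)
    exact ⟨n + 1, mem_of_superset (isOpen_interior.mem_nhds hn) (interior_subset.trans (hKB n))⟩
  have hmem : ∀ x, ∃ n, x ∈ K n := fun x => (hcov x).imp fun n => mem_of_mem_nhds
  set P : Set X := {x | x ∈ (sq (Nat.find (hmem x))).1.2.1} with hPdef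
  set h : X → C(I, X) := fun x => (sq (Nat.find (hmem x))).1.2.2 x with hh
  have hPK : ∀ n, ∀ x ∈ K n, (x ∈ P ↔ x ∈ (sq n).1.2.1) ∧ (x ∉ P → h x = (sq n).1.2.2 x) := by
    intro n x hx
    have := hcons _ n (Nat.find_min' (hmem x) hx) x (Nat.find_spec (hmem x))
    exact ⟨this.1.symm, fun hxP => (this.2 hxP).symm⟩
  have hcont : ∀ n, ContractsOn id x₀ (sq n).1.2.2 (K n \ (sq n).1.2.1) := by
    intro n
    obtain ⟨-, -, U, -, hU, hUn⟩ := (sq n).2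
    exact hUn.mono (sdiff_subset_sdiff_left hU)
  refine ⟨P, h, fun x => ?_, fun x hx => ?_, fun x hx => ?_⟩
  · obtain ⟨n, hn⟩ := hcov x
    exact ⟨K n, hn, (sq n).2.2.1.subset fun y hy => ((hPK n y hy.1).1).mp hy.2⟩
  · obtain ⟨n, hn⟩ := hcov x
    have hxn := mem_of_mem_nhds hn
    rw [← continuousWithinAt_inter hn]
    have h1 := (hcont n).1 x ⟨hxn, fun h => hx ((hPK n x hxn).1.mpr h)⟩
    refine (h1.mono ?_).congr (fun y hy => (hPK n y hy.2).2 hy.1) ((hPK n x hxn).2 hx)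
    exact fun y hy => ⟨hy.2, fun h => hy.1 ((hPK n y hy.2).1.mpr h)⟩
  · obtain ⟨n, hn⟩ := hmem x
    rw [(hPK n x hn).2 hx]
    exact (hcont n).2 x ⟨hn, fun h => hx ((hPK n x hn).1.mpr h)⟩

end Exhaustion

section Ordering

open Relation

/-- The vertices of an infinite connected locally finite graph can be numbered in such a way that
every vertex has a neighbour with a larger number. -/
theorem exists_injective_nat_forall_exists_lt {V : Type*} [Countable V] [Infinite V]
    {r : V → V → Prop} (hsymm : ∀ v w, r v w → r w v) (hconn : ∀ v w, ReflTransGen r v w)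
    (hfin : ∀ v, {w | r v w}.Finite) :
    ∃ e : V → ℕ, Function.Injective e ∧ ∀ v, ∃ w, r v w ∧ e v < e w := by
  classical
  obtain ⟨c, hc⟩ := exists_injective_nat V
  let T : ℕ → Set V := fun n => {v | c v < n}
  have hTfin : ∀ n, (T n).Finite := fun n => (Set.finite_lt_nat n).preimage hc.injOn
  let s : ℕ → V → V → Prop := fun n a b => r a b ∧ b ∉ T n
  let comp : ℕ → V → Set V := fun n v => {w | ReflTransGen (s n) v w}
  let E : ℕ → Set V := fun n => {v | v ∉ T n ∧ (comp n v).Infinite}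
  have hcompT : ∀ n v, v ∉ T n → ∀ w ∈ comp n v, w ∉ T n := by
    intro n v hv w hw
    induction hw with
    | refl => exact hv
    | tail _ h _ => exact h.2
  have hcomp_symm : ∀ n v, v ∉ T n → ∀ w ∈ comp n v, v ∈ comp n w := by
    intro n v hv w hw
    induction hw with
    | refl => exact ReflTransGen.refl
    | @tail a b h h' ih => exact ReflTransGen.head ⟨hsymm _ _ h'.1, hcompT n v hv a h⟩ ih
  have hE_step : ∀ n, ∀ v ∈ E n, ∀ w, s n v w → w ∈ E n := by
    intro n v hv w hw
    refine ⟨hw.2, hv.2.mono fun u hu => ?_⟩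
    exact ReflTransGen.trans (hcomp_symm n v hv.1 w (ReflTransGen.single hw)) hu
  have hclosed : ∀ (S : Set V) v, v ∈ S → (∀ a ∈ S, ∀ b, r a b → b ∈ S) → S = univ := by
    intro S v hv hS
    refine eq_univ_of_forall fun w => ?_
    induction hconn v w with
    | refl => exact hv
    | tail _ h ih => exact hS _ ih _ h
  have hcofin : ∀ n, (E n)ᶜ.Finite := by
    intro n
    let B : Set V := {u | (∃ t ∈ T n, r t u) ∧ (comp n u).Finite}
    have hB : B.Finite := ((hTfin n).biUnion fun t _ => hfin t).subset fun u hu => by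
      obtain ⟨⟨t, ht, htu⟩, -⟩ := hu
      exact mem_biUnion ht htu
    refine ((hTfin n).union (hB.biUnion (t := fun u => comp n u) fun u hu => hu.2)).subset ?_
    intro v hv
    by_cases hvT : v ∈ T n
    · exact Or.inl hvT
    · have hvf : (comp n v).Finite := by
        by_contra h
        exact hv ⟨hvT, h⟩
      right
      obtain ⟨u, hu, t, ht, hut⟩ : ∃ u ∈ comp n v, ∃ t ∈ T n, r u t := by
        by_contra! hcon
        have := hclosed (comp n v) v ReflTransGen.refl fun a ha b hab =>
          ReflTransGen.tail ha ⟨hab, fun hb => hcon a ha b hb hab⟩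
        rw [this] at hvf
        exact infinite_univ hvf
      exact mem_biUnion (show u ∈ B from ⟨⟨t, ht, hsymm _ _ hut⟩,
        hvf.subset fun w hw => ReflTransGen.trans hu hw⟩) (hcomp_symm n v hvT u hu)
  have hE_anti : Antitone E := by
    intro m n hmn v hv
    have hT : T m ⊆ T n := fun w hw => lt_of_lt_of_le hw hmn
    exact ⟨fun h => hv.1 (hT h), hv.2.mono fun w hw =>
      ReflTransGen.mono (p := s m) (fun a b hab => ⟨hab.1, fun h => hab.2 (hT h)⟩) _ _ hw⟩
  have hE_zero : E 0 = univ := by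
    refine eq_univ_of_forall fun v => ⟨Nat.not_lt_zero _, ?_⟩
    rw [hclosed (comp 0 v) v ReflTransGen.refl fun a ha b hab =>
      ReflTransGen.tail ha ⟨hab, Nat.not_lt_zero _⟩]
    exact infinite_univ
  have hL : ∀ v, ∃ n, v ∈ E n ∧ v ∉ E (n + 1) := by
    intro v
    by_contra! hcon
    have : ∀ n, v ∈ E n := fun n => by
      induction n with
      | zero => rw [hE_zero]; trivial
      | succ n ih => exact hcon n ih
    exact (this (c v + 1)).1 (Nat.lt_succ_self _)
  choose L hLE hLE' using hL
  have hle : ∀ n, ∀ v ∈ E n, n ≤ L v := by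
    intro n v hv
    by_contra! h
    exact hLE' v (hE_anti (Nat.succ_le_of_lt h) hv)
  let D : ℕ → ℕ → Set V := fun n k =>
    Nat.rec (E (n + 1)) (fun _ S => {v | v ∈ E n ∧ ∃ w ∈ S, r v w}) k
  have hDE : ∀ n k, D n k ⊆ E n := by
    rintro n (_ | k)
    · exact hE_anti (Nat.le_succ n)
    · exact fun v hv => hv.1
  have hD : ∀ n, ∀ v ∈ E n, ∃ k, v ∈ D n k := by
    intro n v hv
    obtain ⟨w, hw, hw'⟩ := (hv.2.sdiff (hcofin (n + 1))).nonempty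
    rw [notMem_compl_iff] at hw'
    replace hw : ReflTransGen (s n) v w := hw
    induction hw using ReflTransGen.head_induction_on with
    | refl => exact ⟨0, hw'⟩
    | @head a b hab _ ih =>
      obtain ⟨k, hk⟩ := ih (hE_step n a hv b hab)
      exact ⟨k + 1, hv, b, hk, hab.1⟩
  have hd : ∀ v, ∃ k, v ∈ D (L v) k ∧ ∀ j, v ∈ D (L v) j → k ≤ j := fun v => by
    have h := hD (L v) v (hLE v)
    exact ⟨Nat.find h, Nat.find_spec h, fun j hj => Nat.find_min' h hj⟩
  choose d hdD hdmin using hd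
  let key : V → ℕ ×ₗ (ℕᵒᵈ ×ₗ ℕ) := fun v => toLex (L v, toLex (OrderDual.toDual (d v), c v))
  have hkey_inj : Function.Injective key := fun v w h => hc (by
    have h1 := congrArg (fun p => (ofLex (ofLex p).2).2) h
    exact h1)
  have hkey : ∀ v, ∃ w, r v w ∧ key v < key w := by
    intro v
    have hd := hdD v
    rcases hdv : d v with _ | k
    · rw [hdv] at hd
      exact absurd hd (hLE' v)
    · rw [hdv] at hd
      obtain ⟨-, w, hw, hvw⟩ := hd
      refine ⟨w, hvw, ?_⟩
      rw [Prod.Lex.toLex_lt_toLex]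
      rcases (hle _ w (hDE _ _ hw)).lt_or_eq with hlt | heq
      · exact Or.inl hlt
      · refine Or.inr ⟨heq, ?_⟩
        rw [Prod.Lex.toLex_lt_toLex]
        left
        rw [OrderDual.toDual_lt_toDual, hdv, Nat.lt_succ_iff]
        exact hdmin w k (by rwa [← heq])
  have hkfin : ∀ v, {w | key w < key v}.Finite := by
    intro v
    refine (hcofin (L v + 1)).subset fun w hw hwE => ?_
    have h1 := hle _ w hwE
    have h2 : L w ≤ L v := by
      rcases (Prod.Lex.toLex_lt_toLex.mp hw) with h | h
      · exact h.le
      · exact h.1.le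
    omega
  have hmono : ∀ v w, key v < key w → {u | key u < key v}.ncard < {u | key u < key w}.ncard := by
    intro v w hvw
    refine ncard_lt_ncard ⟨fun u hu => lt_trans hu hvw, fun h => ?_⟩ (hkfin w)
    exact lt_irrefl (key v) (h hvw)
  refine ⟨fun v => {u | key u < key v}.ncard, fun v w hvw => ?_, fun v => ?_⟩
  · rcases lt_trichotomy (key v) (key w) with h | h | h
    · exact absurd hvw (hmono v w h).ne
    · exact hkey_inj h
    · exact absurd hvw (hmono w v h).ne'
  · obtain ⟨w, hw, hlt⟩ := hkey v
    exact ⟨w, hw, hmono v w hlt⟩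

end Ordering

section InfinitePush

variable {X : Type*} [TopologicalSpace X]

/-- `H` is an isotopy-like deformation of the identity, supported in `O`, at the end of which all
the points of `Q` in `O` come from `W`. -/
structure IsPush (O W Q : Set X) (H : C(X × I, X)) : Prop where
  apply_zero : ∀ x, H (x, 0) = x
  apply_of_notMem : ∀ x ∉ O, ∀ t, H (x, t) = x
  injective : Function.Injective fun x => H (x, 1)
  mem_of_apply_mem : ∀ x ∈ O, H (x, 1) ∈ Q ∩ O → x ∈ W

lemma IsPush.apply_mem {O W Q : Set X} {H : C(X × I, X)} (hH : IsPush O W Q H) {x : X}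
    (hx : x ∈ O) : H (x, 1) ∈ O := by
  by_contra h
  have : H (x, 1) = x := hH.injective (hH.apply_of_notMem _ h 1)
  exact h (by rwa [this])

/-- If the points of a locally finite set lying in a member of a locally finite sequence of sets
can always be pushed to a later member of the sequence, then the identity map can be deformed to
a map avoiding the locally finite set. -/
theorem exists_deformation_avoiding {O : ℕ → Set X} (hO : LocallyFinite O) {P : Set X}
    (hP : ∀ i, (P ∩ O i).Finite) (hcov : P ⊆ ⋃ i, O i)
    (hpush : ∀ n (Q : Set X), (∀ i, (Q ∩ O i).Finite) →
      ∃ m > n, ∃ H, IsPush (O n) (O m) Q H) :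
    ∃ G : C(X × I, X), (∀ x, G (x, 0) = x) ∧ ∀ x, G (x, 1) ∉ P := by
  choose m hm H hH using hpush
  let S := {Q : Set X // ∀ i, (Q ∩ O i).Finite}
  have hnext : ∀ n (Q : S), ∀ i, ((fun x => H n Q.1 Q.2 (x, 1)) ⁻¹' Q.1 ∩ O i).Finite := by
    rintro n ⟨Q, hQ⟩ i
    refine ((hQ i).union ((hQ n).preimage (hH n Q hQ).injective.injOn)).subset ?_
    rintro x ⟨hxQ, hxi⟩
    by_cases hx : x ∈ O n
    · exact Or.inr ⟨hxQ, (hH n Q hQ).apply_mem hx⟩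
    · left
      rw [mem_preimage, (hH n Q hQ).apply_of_notMem x hx] at hxQ
      exact ⟨hxQ, hxi⟩
  let Q : ℕ → S := fun n => Nat.rec ⟨P, hP⟩ (fun k R => ⟨_, hnext k R⟩) n
  let K : ℕ → C(X × I, X) := fun n => H n (Q n).1 (Q n).2
  have hK : ∀ n, IsPush (O n) (O (m n (Q n).1 (Q n).2)) (Q n).1 (K n) := fun n => hH n _ _
  have hQ : ∀ n, (Q (n + 1)).1 = (fun x => K n (x, 1)) ⁻¹' (Q n).1 := fun n => rfl
  let G : ℕ → C(X × I, X) := fun n => Nat.rec ⟨Prod.fst, continuous_fst⟩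
    (fun k g => g.comp ⟨fun p => (K k p, p.2), by fun_prop⟩) n
  have hG : ∀ n p, G (n + 1) p = G n (K n p, p.2) := fun n p => rfl
  have hG0 : ∀ n x, G n (x, 0) = x := by
    intro n x
    induction n with
    | zero => rfl
    | succ n ih => rw [hG, (hK n).apply_zero, ih]
  have hGP : ∀ n x, G n (x, 1) ∈ P ↔ x ∈ (Q n).1 := by
    intro n
    induction n with
    | zero => exact fun x => Iff.rfl
    | succ n ih => exact fun x => by rw [hG, hQ, ih]; rfl
  have hQO : ∀ n, ∀ x ∈ (Q n).1, ∃ i ≥ n, x ∈ O i := by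
    intro n
    induction n with
    | zero =>
      intro x hx
      obtain ⟨i, hi⟩ := mem_iUnion.mp (hcov hx)
      exact ⟨i, Nat.zero_le _, hi⟩
    | succ n ih =>
      intro x hx
      rw [hQ, mem_preimage] at hx
      by_cases hxn : x ∈ O n
      · exact ⟨_, hm n (Q n).1 (Q n).2,
          (hK n).mem_of_apply_mem x hxn ⟨hx, (hK n).apply_mem hxn⟩⟩
      · rw [(hK n).apply_of_notMem x hxn] at hx
        obtain ⟨i, hi, hxi⟩ := ih x hx
        refine ⟨i, lt_of_le_of_ne hi ?_, hxi⟩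
        rintro rfl
        exact hxn hxi
  have hlf : LocallyFinite fun n => {p | G (n + 1) p ≠ G n p} := by
    refine (hO.preimage_continuous (continuous_fst (X := X) (Y := I))).subset fun n p hp => ?_
    by_contra hpn
    refine hp ?_
    have : K n p = p.1 := (hK n).apply_of_notMem p.1 hpn p.2
    rw [hG, this]
  obtain ⟨F, hF⟩ := LocallyFinite.exists_forall_eventually_atTop_eventuallyEq
    (f := fun n p => G n p) hlf
  have hFeq : ∀ p, ∀ᶠ n in atTop, G n p = F p := fun p => (hF p).mono fun n hn => hn.eq_of_nhds
  have hFc : Continuous F := continuous_iff_continuousAt.mpr fun p => by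
    obtain ⟨n, hn⟩ := (hF p).exists
    exact (G n).continuous.continuousAt.congr hn
  refine ⟨⟨F, hFc⟩, fun x => ?_, fun x hx => ?_⟩
  · obtain ⟨n, hn⟩ := (hFeq (x, 0)).exists
    exact hn.symm.trans (hG0 n x)
  · replace hx : F (x, 1) ∈ P := hx
    obtain ⟨N, hN⟩ := eventually_atTop.mp (hFeq (x, 1))
    have hxQ : ∀ n ≥ N, x ∈ (Q n).1 := fun n hn => (hGP n x).mp (by rwa [hN n hn])
    obtain ⟨M, hM⟩ := (hO.point_finite x).bddAbove
    obtain ⟨i, hi, hxi⟩ := hQO (max N (M + 1)) x (hxQ _ (le_max_left _ _))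
    have h1 : i ≤ M := hM hxi
    have h2 := le_max_right N (M + 1)
    omega

end InfinitePush

section RadialPush

/-- The radial stretching factor of a map pushing the points of gauge larger than `η` out of the
set of points of gauge smaller than `α`. -/
noncomputable def stretch (α η s : ℝ) : ℝ := max 1 (1 - α + α / max s η)

lemma one_le_stretch (α η s : ℝ) : 1 ≤ stretch α η s := le_max_left _ _

lemma stretch_of_one_le {α η s : ℝ} (hα : 0 ≤ α) (hs : 1 ≤ s) : stretch α η s = 1 := by
  have h1 : 1 ≤ max s η := hs.trans (le_max_left _ _)
  have h2 : α / max s η ≤ α := div_le_self hα h1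
  exact max_eq_left (by linarith)

lemma continuous_stretch {α η : ℝ} (hη : 0 < η) : Continuous (stretch α η) := by
  have : ∀ s : ℝ, max s η ≠ 0 := fun s => (hη.trans_le (le_max_right _ _)).ne'
  unfold stretch
  fun_prop (disch := assumption)

lemma stretch_mul_lt {α η s t : ℝ} (hα : 0 < α) (hα1 : α < 1) (hη : 0 < η) (hs : 0 ≤ s)
    (hst : s < t) : stretch α η s * s < stretch α η t * t := by
  have key : ∀ u : ℝ, 0 ≤ u → stretch α η u * u = max u ((1 - α) * u + α * (u / max u η)) := by
    intro u hu
    rw [stretch, max_mul_of_nonneg _ _ hu, one_mul]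
    congr 1
    ring
  have hmono : s / max s η ≤ t / max t η := by
    have h1 : 0 < max s η := hη.trans_le (le_max_right _ _)
    have h2 : 0 < max t η := hη.trans_le (le_max_right _ _)
    rw [div_le_div_iff₀ h1 h2]
    rcases le_total t η with h | h
    · rw [max_eq_right h, max_eq_right (hst.le.trans h)]
      exact mul_le_mul_of_nonneg_right hst.le hη.le
    · rw [max_eq_left h, mul_comm]
      exact mul_le_mul_of_nonneg_left (le_max_left _ _) (hs.trans hst.le)
  rw [key s hs, key t (hs.trans hst.le)]
  refine max_lt_max hst ?_
  nlinarith

lemma le_stretch_mul {α η s : ℝ} (hα1 : α ≤ 1) (hη : 0 < η) (hs : η ≤ s) :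
    α ≤ stretch α η s * s := by
  have h0 : 0 < s := hη.trans_le hs
  have h1 : (1 - α + α / max s η) * s ≤ stretch α η s * s :=
    mul_le_mul_of_nonneg_right (le_max_right _ _) h0.le
  rw [max_eq_left hs, add_mul, div_mul_cancel₀ _ h0.ne'] at h1
  nlinarith

/-- Inside a ball, finitely many points can be pushed into a neighbourhood of a given point (in
the sense of preimages). -/
lemma exists_push_ball {E : Type*} [NormedAddCommGroup E] [NormedSpace ℝ E] {c w : E} {R : ℝ}
    (hw : w ∈ ball c R) {S : Set E} (hS : S.Finite) (hSR : S ⊆ ball c R) {W : Set E}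
    (hW : W ∈ 𝓝 w) :
    ∃ F : E × ℝ → E, Continuous F ∧ (∀ x, F (x, 0) = x) ∧ (∀ x ∉ ball c R, ∀ t, F (x, t) = x) ∧
      (∀ x ∈ ball c R, ∀ t ∈ Icc (0 : ℝ) 1, F (x, t) ∈ ball c R) ∧
      (Function.Injective fun x => F (x, 1)) ∧ ∀ x, F (x, 1) ∈ S → x ∈ W := by
  set s : Set E := ball (c - w) R with hs
  have hsc : Convex ℝ s := convex_ball _ _
  have hsub : ∀ x, x - w ∈ s ↔ x ∈ ball c R := fun x => by
    rw [hs, mem_ball, mem_ball, dist_sub_right]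
  have hs0 : s ∈ 𝓝 0 := isOpen_ball.mem_nhds (by rw [← sub_self w, hsub]; exact hw)
  have hlt : ∀ x, gauge s (x - w) < 1 ↔ x ∈ ball c R := fun x => by
    rw [gauge_lt_one_iff_mem_interior hsc hs0, isOpen_ball.interior_eq, hsub]
  obtain ⟨α, hα0, hα1, hαS⟩ : ∃ α : ℝ, 0 < α ∧ α < 1 ∧ ∀ p ∈ S, gauge s (p - w) < α := by
    have h1 : ∀ᶠ α : ℝ in 𝓝[<] 1, ∀ p ∈ S, gauge s (p - w) < α := by
      rw [Set.Finite.eventually_all hS]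
      exact fun p hp => (lt_mem_nhds ((hlt p).mpr (hSR hp))).filter_mono nhdsWithin_le_nhds
    have h2 : ∀ᶠ α : ℝ in 𝓝[<] 1, 0 < α :=
      (lt_mem_nhds zero_lt_one).filter_mono nhdsWithin_le_nhds
    obtain ⟨α, hα, hα', hα''⟩ := (h1.and (h2.and self_mem_nhdsWithin)).exists
    exact ⟨α, hα', hα'', hα⟩
  obtain ⟨ε, hε, hεW⟩ := Metric.mem_nhds_iff.mp hW
  obtain ⟨η, hη, hηW⟩ : ∃ η : ℝ, 0 < η ∧ ∀ x, gauge s (x - w) < η → x ∈ W := by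
    set ρ : ℝ := ‖c - w‖ + R with hρ
    have hR : 0 < R := pos_of_mem_ball hw
    have hρ0 : 0 < ρ := by positivity
    refine ⟨ε / ρ, div_pos hε hρ0, fun x hx => hεW ?_⟩
    have hsρ : s ⊆ closedBall 0 ρ := by
      intro y hy
      rw [hs, mem_ball, dist_eq_norm] at hy
      rw [mem_closedBall_zero_iff]
      have := norm_le_norm_sub_add y (c - w)
      linarith
    have h1 := (le_gauge_of_subset_closedBall (x := x - w) (absorbent_nhds_zero hs0) hρ0.le
      hsρ).trans_lt hx
    rw [div_lt_div_iff_of_pos_right hρ0] at h1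
    rwa [mem_ball, dist_eq_norm]
  set μ : E → ℝ := fun x => gauge s (x - w) with hμ
  have hμc : Continuous μ := (continuous_gauge hsc hs0).comp (by fun_prop)
  have hμ0 : ∀ x, 0 ≤ μ x := fun x => gauge_nonneg _
  set κ : E × ℝ → ℝ := fun p => 1 - p.2 + p.2 * stretch α η (μ p.1) with hκ
  have hκc : Continuous κ := by
    have := (continuous_stretch (α := α) hη).comp (hμc.comp (continuous_fst (X := E) (Y := ℝ)))
    simp only [Function.comp_def] at this
    fun_prop
  let F : E × ℝ → E := fun p => w + κ p • (p.1 - w)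
  have hμF : ∀ p, 0 ≤ κ p → μ (F p) = κ p * μ p.1 := fun p hp => by
    simp only [F, μ, add_sub_cancel_left, gauge_smul_of_nonneg hp, smul_eq_mul]
  have hstrict : ∀ u v : ℝ, 0 ≤ u → u < v → stretch α η u * u < stretch α η v * v :=
    fun u v => stretch_mul_lt hα0 hα1 hη
  have hκ1 : ∀ x, κ (x, 1) = stretch α η (μ x) := fun x => by simp [κ]
  have hF1 : ∀ x, μ (F (x, 1)) = stretch α η (μ x) * μ x := fun x => by
    rw [hμF, hκ1]
    rw [hκ1]
    exact zero_le_one.trans (one_le_stretch _ _ _)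
  refine ⟨F, by fun_prop, fun x => by simp [F, κ], fun x hx t => ?_, fun x hx t ht => ?_, ?_, ?_⟩
  · have h1 : 1 ≤ μ x := not_lt.mp fun h => hx ((hlt x).mp h)
    simp [F, κ, stretch_of_one_le hα0.le h1]
  · rw [← hlt] at hx ⊢
    change μ (F (x, t)) < 1
    have h1 := hstrict (μ x) 1 (hμ0 x) hx
    rw [stretch_of_one_le hα0.le le_rfl, one_mul] at h1
    have h2 := one_le_stretch α η (μ x)
    have h3 : 0 ≤ κ (x, t) := by
      simp only [κ]
      nlinarith [ht.1, ht.2]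
    rw [hμF _ h3]
    simp only [κ]
    have h4 : μ x < 1 := hx
    rcases ht.1.eq_or_lt with h | h
    · rw [← h]; linarith
    · nlinarith [ht.2]
  · intro x y hxy
    have h1 : stretch α η (μ x) * μ x = stretch α η (μ y) * μ y := by
      rw [← hF1, ← hF1]
      exact congrArg μ hxy
    have h2 : μ x = μ y := by
      rcases lt_trichotomy (μ x) (μ y) with h | h | h
      · exact absurd h1 (hstrict _ _ (hμ0 x) h).ne
      · exact h
      · exact absurd h1 (hstrict _ _ (hμ0 y) h).ne'
    simp only [F, hκ1, h2, add_right_inj] at hxy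
    have h3 : stretch α η (μ y) ≠ 0 := (zero_lt_one.trans_le (one_le_stretch _ _ _)).ne'
    exact sub_left_injective (smul_right_injective E h3 hxy)
  · intro x hx
    refine hηW x ?_
    by_contra! h
    have h1 := le_stretch_mul (α := α) hα1.le hη h
    have h2 := hαS _ hx
    change μ (F (x, 1)) < α at h2
    rw [hF1] at h2
    exact absurd h1 (not_le.mpr h2)

lemma isPush_fst_empty {X : Type*} [TopologicalSpace X] (W Q : Set X) :
    IsPush ∅ W Q ⟨Prod.fst, continuous_fst⟩ where
  apply_zero _ := rfl
  apply_of_notMem _ _ _ := rfl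
  injective _ _ h := h
  mem_of_apply_mem _ h := h.elim

/-- In a ball in a chart, finitely many points can be pushed into any open set meeting the ball. -/
theorem exists_isPush {X E : Type*} [TopologicalSpace X] [T2Space X]
    [NormedAddCommGroup E] [NormedSpace ℝ E] [ProperSpace E]
    (φ : OpenPartialHomeomorph X E) {c : E} {R : ℝ} (hR : closedBall c R ⊆ φ.target)
    {Q W : Set X} (hQ : (Q ∩ φ.symm '' ball c R).Finite) (hW : IsOpen W)
    (hWR : (φ.symm '' ball c R ∩ W).Nonempty) :
    ∃ H, IsPush (φ.symm '' ball c R) W Q H := by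
  classical
  set O : Set X := φ.symm '' ball c R with hO
  have hbt : ball c R ⊆ φ.target := ball_subset_closedBall.trans hR
  have hOo : IsOpen O := φ.symm.isOpen_image_of_subset_source isOpen_ball hbt
  have hOs : O ⊆ φ.source := by
    rintro _ ⟨y, hy, rfl⟩
    exact φ.map_target (hbt hy)
  have hφO : ∀ x ∈ O, φ x ∈ ball c R := by
    rintro _ ⟨y, hy, rfl⟩
    rwa [φ.right_inv (hbt hy)]
  obtain ⟨_, ⟨w, hw, rfl⟩, hwW⟩ := hWR
  have hSf : (φ '' (Q ∩ O)).Finite := hQ.image _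
  obtain ⟨R', hR'R, hwR', hSR'⟩ : ∃ R' < R, w ∈ ball c R' ∧ φ '' (Q ∩ O) ⊆ ball c R' := by
    have h1 : ∀ᶠ R' : ℝ in 𝓝[<] R, ∀ p ∈ insert w (φ '' (Q ∩ O)), dist p c < R' := by
      rw [Set.Finite.eventually_all (hSf.insert w)]
      intro p hp
      have : dist p c < R := by
        rcases hp with rfl | ⟨x, hx, rfl⟩
        · exact hw
        · exact hφO x hx.2
      exact (lt_mem_nhds this).filter_mono nhdsWithin_le_nhds
    obtain ⟨R', h, h'⟩ := (h1.and self_mem_nhdsWithin).exists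
    exact ⟨R', h', h w (mem_insert _ _), fun p hp => h p (mem_insert_of_mem _ hp)⟩
  have hWn : φ.symm ⁻¹' W ∈ 𝓝 w :=
    (φ.continuousAt_symm (hbt hw)).preimage_mem_nhds (hW.mem_nhds hwW)
  obtain ⟨F, hFc, hF0, hFout, hFin, hFinj, hFS⟩ := exists_push_ball hwR' hSf hSR' hWn
  have hFR : ∀ y ∈ ball c R, ∀ t ∈ Icc (0 : ℝ) 1, F (y, t) ∈ ball c R := by
    intro y hy t ht
    by_cases hy' : y ∈ ball c R'
    · exact ball_subset_ball hR'R.le (hFin y hy' t ht)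
    · rwa [hFout y hy' t]
  have hNc : IsClosed (φ.symm '' closedBall c R') :=
    ((isCompact_closedBall c R').image_of_continuousOn (φ.continuousOn_symm.mono
      ((closedBall_subset_closedBall hR'R.le).trans hR))).isClosed
  let H : X × I → X := fun p => if p.1 ∈ O then φ.symm (F (φ p.1, p.2)) else p.1
  have hHin : ∀ x ∈ O, ∀ t : I, H (x, t) = φ.symm (F (φ x, t)) := fun x hx t => if_pos hx
  have hHout : ∀ x, x ∉ φ.symm '' closedBall c R' → ∀ t : I, H (x, t) = x := by
    intro x hx t
    by_cases hxO : x ∈ O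
    · have : φ x ∉ ball c R' := fun h =>
        hx ⟨φ x, ball_subset_closedBall h, φ.left_inv (hOs hxO)⟩
      rw [hHin x hxO, hFout _ this, φ.left_inv (hOs hxO)]
    · exact if_neg hxO
  have hHc : Continuous H := by
    rw [continuous_iff_continuousAt]
    rintro ⟨x, t⟩
    by_cases hx : x ∈ O
    · have h1 : ContinuousAt (fun p : X × I => φ.symm (F (φ p.1, p.2))) (x, t) := by
        have h2 : ContinuousAt (fun p : X × I => F (φ p.1, (p.2 : ℝ))) (x, t) :=
          hFc.continuousAt.comp (((φ.continuousAt (hOs hx)).comp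
            (f := (Prod.fst : X × I → X)) (x := (x, t)) continuousAt_fst).prodMk (by fun_prop))
        exact ContinuousAt.comp (f := fun p : X × I => F (φ p.1, (p.2 : ℝ)))
          (φ.continuousAt_symm (hbt (hFR _ (hφO x hx) t t.2))) h2
      refine h1.congr ?_
      filter_upwards [(hOo.preimage continuous_fst).mem_nhds (show (x, t) ∈ Prod.fst ⁻¹' O from hx)]
        with p hp
      exact (hHin p.1 hp p.2).symm
    · have hx' : x ∉ φ.symm '' closedBall c R' := by
        rintro ⟨y, hy, rfl⟩
        exact hx ⟨y, closedBall_subset_ball hR'R hy, rfl⟩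
      refine (continuousAt_fst (X := X) (Y := I)).congr ?_
      filter_upwards [(hNc.isOpen_compl.preimage continuous_fst).mem_nhds
        (show (x, t) ∈ Prod.fst ⁻¹' (φ.symm '' closedBall c R')ᶜ from hx')] with p hp
      exact (hHout p.1 hp p.2).symm
  have hφH : ∀ x ∈ O, φ (H (x, 1)) = F (φ x, 1) := fun x hx => by
    have h1 := hFR _ (hφO x hx) 1 ⟨zero_le_one, le_rfl⟩
    rw [hHin x hx, Icc.coe_one, φ.right_inv (hbt h1)]
  have hHO : ∀ x, x ∈ O ↔ H (x, 1) ∈ O := fun x => by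
    by_cases hx : x ∈ O
    · refine iff_of_true hx ?_
      rw [hHin x hx]
      exact ⟨_, hFR _ (hφO x hx) _ (1 : I).2, rfl⟩
    · have : H (x, 1) = x := if_neg hx
      rw [this]
  refine ⟨⟨H, hHc⟩, fun x => ?_, fun x hx t => if_neg hx, fun x y hxy => ?_, fun x hx hxQ => ?_⟩
  · by_cases hx : x ∈ O
    · refine (hHin x hx 0).trans ?_
      rw [Icc.coe_zero, hF0, φ.left_inv (hOs hx)]
    · exact if_neg hx
  · replace hxy : H (x, 1) = H (y, 1) := hxy
    by_cases hx : x ∈ O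
    · have hy : y ∈ O := by rwa [hHO, ← hxy, ← hHO]
      have h1 := hφH x hx
      rw [hxy, hφH y hy] at h1
      rw [← φ.left_inv (hOs hx), ← φ.left_inv (hOs hy)]
      exact congrArg φ.symm (hFinj h1.symm)
    · have hy : y ∉ O := by rwa [hHO, ← hxy, ← hHO]
      have h1 : H (x, 1) = x := if_neg hx
      have h2 : H (y, 1) = y := if_neg hy
      rw [← h1, ← h2, hxy]
  · have h1 := hFS (φ x) (hφH x hx ▸ mem_image_of_mem φ hxQ)
    rwa [mem_preimage, φ.left_inv (hOs hx)] at h1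

end RadialPush

section Cover

universe u

variable {X : Type u} {E : Type*} [TopologicalSpace X] [NormedAddCommGroup E]

lemma hasBasis_nhds_symm_image_ball (φ : OpenPartialHomeomorph X E) {x : X} (hx : x ∈ φ.source)
    {R : ℝ} (hR : 0 < R) :
    (𝓝 x).HasBasis (fun r => 0 < r ∧ r ≤ R) fun r => φ.symm '' ball (φ x) r := by
  have h1 : (𝓝 (φ x)).HasBasis (fun r => 0 < r ∧ r ≤ R) (ball (φ x)) :=
    nhds_basis_ball.to_hasBasis
      (fun r hr => ⟨min r R, ⟨lt_min hr hR, min_le_right _ _⟩, ball_subset_ball (min_le_left _ _)⟩)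
      fun r hr => ⟨r, hr.1, subset_rfl⟩
  have h2 := h1.map φ.symm
  rwa [φ.symm_map_nhds_eq hx] at h2

/-- A space with charts in `E` has a locally finite cover by open balls in charts. -/
theorem exists_locallyFinite_cover_ball [T2Space X] [LocallyCompactSpace X] [SigmaCompactSpace X]
    (φ : X → OpenPartialHomeomorph X E) (hφ : ∀ x, x ∈ (φ x).source) :
    ∃ (V : Type u) (c : V → X) (r : V → ℝ),
      (∀ v, 0 < r v ∧ closedBall (φ (c v) (c v)) (r v) ⊆ (φ (c v)).target) ∧
      (⋃ v, (φ (c v)).symm '' ball (φ (c v) (c v)) (r v)) = univ ∧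
      LocallyFinite fun v => (φ (c v)).symm '' ball (φ (c v) (c v)) (r v) := by
  choose R hR hRt using fun x => exists_chart_closedBall (φ x) (hφ x)
  obtain ⟨V, c, r, hr, hU, hfin⟩ := refinement_of_locallyCompact_sigmaCompact_of_nhds_basis
    fun x => hasBasis_nhds_symm_image_ball (φ x) (hφ x) (hR x)
  exact ⟨V, c, r, fun v => ⟨(hr v).1, (closedBall_subset_closedBall (hr v).2).trans (hRt _)⟩,
    hU, hfin⟩

/-- The members of an open cover of a connected space are connected through chains of
intersecting members. -/
lemma reflTransGen_inter_nonempty [PreconnectedSpace X] {V : Type*} {O : V → Set X}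
    (hO : ∀ v, IsOpen (O v)) (hne : ∀ v, (O v).Nonempty) (hU : ⋃ v, O v = univ) (v w : V) :
    Relation.ReflTransGen (fun v w => (O v ∩ O w).Nonempty) v w := by
  set r : V → V → Prop := fun v w => (O v ∩ O w).Nonempty
  by_contra hvw
  have hA : IsOpen (⋃ u ∈ {u | Relation.ReflTransGen r v u}, O u) :=
    isOpen_biUnion fun u _ => hO u
  have hB : IsOpen (⋃ u ∈ {u | ¬ Relation.ReflTransGen r v u}, O u) :=
    isOpen_biUnion fun u _ => hO u
  have hAB : (univ : Set X) ⊆ (⋃ u ∈ {u | Relation.ReflTransGen r v u}, O u) ∪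
      ⋃ u ∈ {u | ¬ Relation.ReflTransGen r v u}, O u := by
    intro x _
    obtain ⟨u, hu⟩ := mem_iUnion.mp (hU.symm ▸ mem_univ x)
    by_cases h : Relation.ReflTransGen r v u
    · exact Or.inl (mem_biUnion (x := u) h hu)
    · exact Or.inr (mem_biUnion (x := u) h hu)
  obtain ⟨x, hx⟩ := hne v
  obtain ⟨y, hy⟩ := hne w
  obtain ⟨z, -, hz1, hz2⟩ := isPreconnected_univ _ _ hA hB hAB
    ⟨x, mem_univ x, mem_biUnion (x := v) Relation.ReflTransGen.refl hx⟩
    ⟨y, mem_univ y, mem_biUnion (x := w) hvw hy⟩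
  obtain ⟨a, ha, hza⟩ := mem_iUnion₂.mp hz1
  obtain ⟨b, hb, hzb⟩ := mem_iUnion₂.mp hz2
  exact hb (Relation.ReflTransGen.tail ha ⟨z, hza, hzb⟩)

/-- A compact set meets a locally finite set in a finite set. -/
lemma _root_.IsCompact.finite_inter_of_forall_nhds {K P : Set X} (hK : IsCompact K)
    (hP : ∀ x, ∃ W ∈ 𝓝 x, (W ∩ P).Finite) : (P ∩ K).Finite := by
  refine hK.induction_on (p := fun K => (P ∩ K).Finite) (by simp)
    (fun s t hst ht => ht.subset (inter_subset_inter_right _ hst))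
    (fun s t hs ht => by rw [inter_union_distrib_left]; exact hs.union ht) fun x _ => ?_
  obtain ⟨W, hW, hWP⟩ := hP x
  exact ⟨W, mem_nhdsWithin_of_mem_nhds hW, by rwa [inter_comm]⟩

/-- In a noncompact connected manifold, the identity map can be deformed to a map avoiding a given
locally finite set. -/
theorem exists_deformation_avoiding_of_noncompact [NormedSpace ℝ E] [ProperSpace E] [T2Space X]
    [LocallyCompactSpace X] [SigmaCompactSpace X] [PreconnectedSpace X] [NoncompactSpace X]
    (hφ : ∀ x : X, ∃ φ : OpenPartialHomeomorph X E, x ∈ φ.source) {P : Set X}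
    (hP : ∀ x, ∃ W ∈ 𝓝 x, (W ∩ P).Finite) :
    ∃ G : C(X × I, X), (∀ x, G (x, 0) = x) ∧ ∀ x, G (x, 1) ∉ P := by
  choose φ hφ using hφ
  obtain ⟨V, c, r, hr, hU, hfin⟩ := exists_locallyFinite_cover_ball φ hφ
  set O : V → Set X := fun v => (φ (c v)).symm '' ball (φ (c v) (c v)) (r v) with hOdef
  set K : V → Set X := fun v => (φ (c v)).symm '' closedBall (φ (c v) (c v)) (r v) with hKdef
  have hOK : ∀ v, O v ⊆ K v := fun v => image_mono ball_subset_closedBall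
  have hK : ∀ v, IsCompact (K v) := fun v =>
    (isCompact_closedBall _ _).image_of_continuousOn ((φ (c v)).continuousOn_symm.mono (hr v).2)
  have hO : ∀ v, IsOpen (O v) := fun v =>
    isOpen_symm_image_ball _ (ball_subset_closedBall.trans (hr v).2)
  have hne : ∀ v, (O v).Nonempty := fun v => (nonempty_ball.mpr (hr v).1).image _
  have hPO : ∀ v, (P ∩ O v).Finite := fun v =>
    ((hK v).finite_inter_of_forall_nhds hP).subset (inter_subset_inter_right _ (hOK v))
  have : Countable V := countable_univ_iff.mp (hfin.countable_univ hne)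
  have : Infinite V := by
    by_contra h
    rw [not_infinite_iff_finite] at h
    refine noncompact_univ X ?_
    have h1 : (⋃ v, K v) = univ := univ_subset_iff.mp (hU ▸ iUnion_mono hOK)
    exact h1 ▸ isCompact_iUnion hK
  obtain ⟨e, he, hlt⟩ := exists_injective_nat_forall_exists_lt
    (r := fun v w => (O v ∩ O w).Nonempty) (fun v w h => by rwa [inter_comm])
    (reflTransGen_inter_nonempty hO hne hU) fun v =>
      (hfin.finite_nonempty_inter_compact (hK v)).subset fun w ⟨x, hxv, hxw⟩ =>
        ⟨x, hxw, hOK v hxv⟩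
  have hOe : ∀ v, ⋃ (w) (_ : e w = e v), O w = O v := by
    intro v
    ext x
    simp only [mem_iUnion, he.eq_iff, exists_prop, exists_eq_left]
  have hOn : ∀ n, (∃ v, n = e v) ∨ ⋃ (w) (_ : e w = n), O w = ∅ := by
    intro n
    by_cases h : ∃ v, n = e v
    · exact Or.inl h
    · refine Or.inr (by simpa only [iUnion_eq_empty] using fun w hw => (h ⟨w, hw.symm⟩).elim)
  refine exists_deformation_avoiding (O := fun n => ⋃ (w) (_ : e w = n), O w) ?_ ?_ ?_ ?_
  · intro x
    obtain ⟨t, ht, hft⟩ := hfin x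
    refine ⟨t, ht, (hft.image e).subset ?_⟩
    rintro n ⟨y, hy, hyt⟩
    obtain ⟨w, rfl, hw⟩ := mem_iUnion₂.mp hy
    exact ⟨w, ⟨y, hw, hyt⟩, rfl⟩
  · intro n
    obtain ⟨v, rfl⟩ | h := hOn n
    · rw [hOe]
      exact hPO v
    · rw [h, inter_empty]
      exact finite_empty
  · intro x _
    obtain ⟨v, hv⟩ := mem_iUnion.mp (hU.symm ▸ mem_univ x)
    exact mem_iUnion.mpr ⟨e v, (hOe v).symm ▸ hv⟩
  · intro n Q hQ
    obtain ⟨v, rfl⟩ | h := hOn n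
    · obtain ⟨w, hvw, hlt⟩ := hlt v
      refine ⟨e w, hlt, ?_⟩
      have hQv := hQ (e v)
      simp only [hOe] at hQv ⊢
      exact exists_isPush (φ (c v)) (hr v).2 hQv (hO w) hvw
    · refine ⟨n + 1, n.lt_succ_self, ?_⟩
      simp only [h]
      exact ⟨_, isPush_fst_empty _ _⟩

end Cover

section Contractible

/-- A noncompact connected manifold modelled on `ℝ³` in which the loops of dimension at most two
are null-homotopic is contractible. -/
theorem contractibleSpace_of_noncompact {X : Type*} [TopologicalSpace X] [ConnectedSpace X]
    [T2Space X] [LocallyCompactSpace X] [SecondCountableTopology X] [NoncompactSpace X]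
    (hφ : ∀ x : X, ∃ φ : OpenPartialHomeomorph X (Fin 3 → ℝ), x ∈ φ.source)
    (hX : ∀ a, ¬ IsTop a → CubeLoopsNull (Directions a) X) : ContractibleSpace X := by
  obtain ⟨x₀⟩ : Nonempty X := inferInstance
  obtain ⟨P, h, hP, hh⟩ := exists_contractsOn_compl hX hφ x₀
  obtain ⟨G, hG0, hG1⟩ := exists_deformation_avoiding_of_noncompact hφ hP
  let F : C(X, X) := ⟨fun x => G (x, 1), by fun_prop⟩
  have hhF : Continuous fun x => h (F x) := hh.1.comp_continuous F.continuous hG1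
  have hF : ContinuousMap.Homotopic (ContinuousMap.id X) F :=
    ⟨{ toFun := fun p => G (p.2, p.1)
       continuous_toFun := by fun_prop
       map_zero_left := hG0
       map_one_left := fun x => rfl }⟩
  have hc : ContinuousMap.Homotopic F (ContinuousMap.const X x₀) :=
    ⟨{ toFun := fun p => h (F p.2) p.1
       continuous_toFun := by
         exact ContinuousEval.continuous_eval.comp
           ((hhF.comp continuous_snd).prodMk continuous_fst)
       map_zero_left := fun x => (hh.2 _ (hG1 x)).1
       map_one_left := fun x => (hh.2 _ (hG1 x)).2 }⟩
  exact (contractible_iff_id_nullhomotopic X).mpr ⟨x₀, hF.trans hc⟩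

end Contractible

end OpenThreeManifold

/-- **Open aspherical simply connected 3-manifolds are contractible.**
Let `X` be a connected, second-countable, Hausdorff topological 3-manifold without
boundary (locally homeomorphic to `ℝ³`, encoded as a charted space over
`EuclideanSpace ℝ (Fin 3)`).  If `X` is noncompact, simply connected and has
trivial second homotopy group, then `X` is contractible. -/
theorem contractible_of_noncompact_simplyConnected_pi2_trivial
    (X : Type*) [TopologicalSpace X] [ConnectedSpace X]
    [SecondCountableTopology X] [T2Space X]
    [ChartedSpace (EuclideanSpace ℝ (Fin 3)) X]
    [NoncompactSpace X] [SimplyConnectedSpace X]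
    (hpi2 : ∀ x : X, Subsingleton (HomotopyGroup (Fin 2) X x)) :
    ContractibleSpace X := by
  have : LocallyCompactSpace X := ChartedSpace.locallyCompactSpace (EuclideanSpace ℝ (Fin 3)) X
  refine OpenThreeManifold.contractibleSpace_of_noncompact (fun x => ?_) fun a ha => ?_
  · exact ⟨(chartAt (EuclideanSpace ℝ (Fin 3)) x).transHomeomorph
      (EuclideanSpace.equiv (Fin 3) ℝ).toHomeomorph, mem_chart_source _ x⟩
  · refine OpenThreeManifold.cubeLoopsNull_of_card_le_two hpi2 ?_
    obtain ⟨i, hi⟩ := not_forall.mp ha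
    have := Fintype.card_subtype_lt (p := fun i => a i % 2 = 1) hi
    rw [Fintype.card_fin] at this
    exact Nat.le_of_lt_succ this
end
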